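/- Let f ∈ D(μ) ∩ H^∞ be an outer function. Then Z̲([f]_{D(μ)}) ⊆ Z̲(f) ∩ supp(μ), where Z̲([f]_{D(μ)}) := ⋂_{g ∈ [f]_{D(μ)}} Z̲(g). -/

import Mathlib

open MeasureTheory Metric Filter Complex Set
open scoped ENNReal Topology

noncomputable section

namespace DirichletMu

/-- The open unit disc in `ℂ`. -/
def disc : Set ℂ := Metric.ball 0 1

/-- The unit circle `𝕋`. -/
def circleT : Set ℂ := Metric.sphere 0 1

/-- The boundary point `e^{it}`. -/
def bpt (t : ℝ) : ℂ := Complex.exp (Complex.I * (t : ℂ))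

/-- Arc-length parametrizing measure on `(0, 2π]`. -/
def θm : Measure ℝ := volume.restrict (Set.Ioc 0 (2 * Real.pi))

/-- A measure is carried by the unit circle. -/
def OnCircle (μ : Measure ℂ) : Prop := μ circleTᶜ = 0

/-- The mean-square integrals of `f` over circles of radius `r < 1`. -/
def hardySet (f : ℂ → ℂ) : Set ℝ :=
  {x | ∃ r : ℝ, 0 < r ∧ r < 1 ∧
    x = (1 / (2 * Real.pi)) * ∫ t in (0:ℝ)..(2 * Real.pi), ‖f ((r : ℂ) * bpt t)‖ ^ 2}

/-- Membership in the Hardy space `H²`. -/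
def MemHardy2 (f : ℂ → ℂ) : Prop :=
  DifferentiableOn ℂ f disc ∧ BddAbove (hardySet f)

/-- The squared Hardy norm. -/
def hardyNormSq (f : ℂ → ℂ) : ℝ := sSup (hardySet f)

/-- Membership in `H^∞`. -/
def MemHinf (f : ℂ → ℂ) : Prop :=
  DifferentiableOn ℂ f disc ∧ ∃ C : ℝ, ∀ z ∈ disc, ‖f z‖ ≤ C

/-- The sup norm over the disc. -/
def supNorm (f : ℂ → ℂ) : ℝ := sSup ((fun z => ‖f z‖) '' disc)

/-- The Poisson integral of the measure `μ`. -/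
def poissonMu (μ : Measure ℂ) (z : ℂ) : ℝ :=
  ∫ ζ, (1 - ‖z‖ ^ 2) / ‖1 - (starRingEnd ℂ) ζ * z‖ ^ 2 ∂μ

/-- The integrand of the Dirichlet integral. -/
def dirichletDensity (μ : Measure ℂ) (f : ℂ → ℂ) (z : ℂ) : ℝ :=
  ‖deriv f z‖ ^ 2 * poissonMu μ z

/-- The Dirichlet integral `D_μ(f)`. -/
def dirichletIntegral (μ : Measure ℂ) (f : ℂ → ℂ) : ℝ :=
  (1 / Real.pi) * ∫ z in disc, dirichletDensity μ f z

/-- Membership in the Dirichlet-type space `D(μ)`. -/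
def MemD (μ : Measure ℂ) (f : ℂ → ℂ) : Prop :=
  MemHardy2 f ∧ IntegrableOn (dirichletDensity μ f) disc

/-- The squared norm `‖f‖_μ²` of `D(μ)`. -/
def dNormSq (μ : Measure ℂ) (f : ℂ → ℂ) : ℝ :=
  hardyNormSq f + dirichletIntegral μ f

/-- `f` has radial limit `L` at `ζ`. -/
def HasRadialLimitAt (f : ℂ → ℂ) (ζ L : ℂ) : Prop :=
  Tendsto (fun r : ℝ => f ((r : ℂ) * ζ)) (nhdsWithin 1 (Set.Iio 1)) (nhds L)

/-- The modulus of `f` has radial limit `m` at `e^{it}`. -/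
def BoundaryAbs (f : ℂ → ℂ) (t : ℝ) (m : ℝ) : Prop :=
  Tendsto (fun r : ℝ => ‖f ((r : ℂ) * bpt t)‖) (nhdsWithin 1 (Set.Iio 1)) (nhds m)

/-- The boundary zero set `Z_𝕋(f)`. -/
def ZT (f : ℂ → ℂ) : Set ℂ :=
  {ζ | ζ ∈ circleT ∧ HasRadialLimitAt f ζ 0}

/-- The set `Z̲(f)`. -/
def Zlow (f : ℂ → ℂ) : Set ℂ :=
  {ζ | ζ ∈ Metric.closedBall (0 : ℂ) 1 ∧
    Filter.liminf (fun z => ‖f z‖) (nhdsWithin ζ disc) = 0}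

def ZlowSet (S : Set (ℂ → ℂ)) : Set ℂ := ⋂ f ∈ S, Zlow f

def ZTSet (S : Set (ℂ → ℂ)) : Set ℂ := ⋂ f ∈ S, ZT f

/-- `[f]_{D(μ)}`: the closure in `D(μ)` of the polynomial multiples of `f`. -/
def closedSpan (μ : Measure ℂ) (f : ℂ → ℂ) : Set (ℂ → ℂ) :=
  {g | MemD μ g ∧ ∀ ε > 0, ∃ q : Polynomial ℂ,
    dNormSq μ (fun z => g z - q.eval z * f z) < ε}

/-- `f` is cyclic for `D(μ)`. -/
def IsCyclic (μ : Measure ℂ) (f : ℂ → ℂ) : Prop :=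
  closedSpan μ f = {g | MemD μ g}

/-- `f` is the outer function with boundary modulus `φ` (parametrized by `e^{it}`). -/
def OuterWith (f : ℂ → ℂ) (φ : ℝ → ℝ) : Prop :=
  (∀ t, 0 ≤ φ t) ∧
  IntervalIntegrable (fun t => Real.log (φ t)) volume 0 (2 * Real.pi) ∧
  ∀ z ∈ disc, f z = Complex.exp (((2 * Real.pi : ℝ) : ℂ)⁻¹ *
    ∫ t in (0:ℝ)..(2 * Real.pi), ((bpt t + z) / (bpt t - z)) * (Real.log (φ t) : ℂ))

/-- `f` is an outer function. -/
def IsOuter (f : ℂ → ℂ) : Prop := ∃ φ, OuterWith f φ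

/-- Inner functions. -/
def IsInner (f : ℂ → ℂ) : Prop :=
  DifferentiableOn ℂ f disc ∧ (∀ z ∈ disc, ‖f z‖ ≤ 1) ∧
  ∀ᵐ t ∂θm, BoundaryAbs f t 1

/-- `f / Θ ∈ H²`. -/
def InnerDivides (Θ f : ℂ → ℂ) : Prop :=
  ∃ g, MemHardy2 g ∧ ∀ z ∈ disc, f z = Θ z * g z

/-- `Θ / Θ'` is bounded on the disc. -/
def DividesBdd (Θ' Θ : ℂ → ℂ) : Prop :=
  ∃ g, MemHinf g ∧ ∀ z ∈ disc, Θ z = Θ' z * g z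

/-- `Θ` is the greatest common inner divisor of the family `M`. -/
def IsGCDInner (M : Set (ℂ → ℂ)) (Θ : ℂ → ℂ) : Prop :=
  IsInner Θ ∧ (∀ f ∈ M, InnerDivides Θ f) ∧
  ∀ Θ', IsInner Θ' → (∀ f ∈ M, InnerDivides Θ' f) → DividesBdd Θ' Θ

/-- The set `Θ H²`. -/
def innerMulH2 (Θ : ℂ → ℂ) : Set (ℂ → ℂ) :=
  {h | ∃ g, MemHardy2 g ∧ ∀ z ∈ disc, h z = Θ z * g z}

/-- Poisson extension of a boundary function (parametrized by `e^{it}`). -/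
def poissonExt (u : ℝ → ℝ) (z : ℂ) : ℝ :=
  (1 / (2 * Real.pi)) * ∫ t in (0:ℝ)..(2 * Real.pi),
    ((1 - ‖z‖ ^ 2) / ‖bpt t - z‖ ^ 2) * u t

/-- `|∇ P[u]|² P_μ`. -/
def gradDensity (μ : Measure ℂ) (u : ℝ → ℝ) (z : ℂ) : ℝ :=
  ‖fderiv ℝ (poissonExt u) z‖ ^ 2 * poissonMu μ z

/-- Membership in the harmonic Dirichlet space `D^h(μ)`. -/
def MemDh (μ : Measure ℂ) (u : ℝ → ℝ) : Prop :=
  IntegrableOn (fun t => (u t) ^ 2) (Set.Ioc 0 (2 * Real.pi)) volume ∧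
  IntegrableOn (gradDensity μ u) disc

/-- The squared norm of `D^h(μ)`. -/
def dhNormSq (μ : Measure ℂ) (u : ℝ → ℝ) : ℝ :=
  (1 / (2 * Real.pi)) * (∫ t in Set.Ioc 0 (2 * Real.pi), (u t) ^ 2) +
  (1 / Real.pi) * ∫ z in disc, gradDensity μ u z

/-- Relatively open subsets of the circle. -/
def RelOpen (U : Set ℂ) : Prop := ∃ V : Set ℂ, IsOpen V ∧ U = V ∩ circleT

/-- Capacity of a relatively open subset of the circle. -/
def capOpen (μ : Measure ℂ) (U : Set ℂ) : ℝ≥0∞ :=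
  ⨅ (u : ℝ → ℝ) (_ : MemDh μ u ∧ (∀ t, 0 ≤ u t) ∧
      ∀ᵐ t ∂θm, bpt t ∈ U → 1 ≤ u t),
    ENNReal.ofReal (dhNormSq μ u)

/-- The capacity `c_μ` of an arbitrary subset of the circle. -/
def cap (μ : Measure ℂ) (F : Set ℂ) : ℝ≥0∞ :=
  ⨅ (U : Set ℂ) (_ : RelOpen U ∧ F ⊆ U), capOpen μ U

/-- The (closed) support of a measure on `ℂ`. -/
def msupport (μ : Measure ℂ) : Set ℂ :=
  {x | ∀ r > 0, 0 < μ (Metric.ball x r)}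

/-- `M_μ(E)`: functions of `D(μ)` whose radial limits vanish `c_μ`-q.e. on `E`. -/
def Mspace (μ : Measure ℂ) (E : Set ℂ) : Set (ℂ → ℂ) :=
  {g | MemD μ g ∧ ∃ N : Set ℂ, cap μ N = 0 ∧ ∀ ζ ∈ E \ N, HasRadialLimitAt g ζ 0}

/-- Closed shift-invariant subspaces of `D(μ)` (closedness for the `D(μ)` norm). -/
structure ClosedInvSubspace (μ : Measure ℂ) (M : Set (ℂ → ℂ)) : Prop where
  subset : M ⊆ {f | MemD μ f}
  zero_mem : (fun _ => (0 : ℂ)) ∈ M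
  add_mem : ∀ f ∈ M, ∀ g ∈ M, (fun z => f z + g z) ∈ M
  smul_mem : ∀ (c : ℂ), ∀ f ∈ M, (fun z => c * f z) ∈ M
  shift_mem : ∀ f ∈ M, (fun z => z * f z) ∈ M
  closed : ∀ g, MemD μ g →
    (∀ ε > 0, ∃ h ∈ M, dNormSq μ (fun z => g z - h z) < ε) → g ∈ M

/-- The norm `‖f‖_{∞,μ}` of the Banach algebra `D(μ) ∩ H^∞`. -/
def algNorm (μ : Measure ℂ) (f : ℂ → ℂ) : ℝ :=
  supNorm f + Real.sqrt (dirichletIntegral μ f)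

/-- Membership in the Banach algebra `D(μ) ∩ H^∞`. -/
def MemA (μ : Measure ℂ) (f : ℂ → ℂ) : Prop := MemD μ f ∧ MemHinf f

/-- Closed ideals of `D(μ) ∩ H^∞`. -/
structure ClosedIdeal (μ : Measure ℂ) (J : Set (ℂ → ℂ)) : Prop where
  subset : J ⊆ {f | MemA μ f}
  zero_mem : (fun _ => (0 : ℂ)) ∈ J
  add_mem : ∀ f ∈ J, ∀ g ∈ J, (fun z => f z + g z) ∈ J
  mul_mem : ∀ f, MemA μ f → ∀ g ∈ J, (fun z => f z * g z) ∈ J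
  closed : ∀ g, MemA μ g →
    (∀ ε > 0, ∃ h ∈ J, algNorm μ (fun z => g z - h z) < ε) → g ∈ J

/-- A multiplier of `D(μ)`. -/
def IsMultiplier (μ : Measure ℂ) (φ : ℂ → ℂ) : Prop :=
  DifferentiableOn ℂ φ disc ∧ ∀ g, MemD μ g → MemD μ (fun z => φ z * g z)

/-- Distance between two subsets of `ℂ`. -/
def setDist (A B : Set ℂ) : ℝ :=
  sInf ((fun p : ℂ × ℂ => dist p.1 p.2) '' (A ×ˢ B))

theorem norm_bpt (t : ℝ) : ‖bpt t‖ = 1 := by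
  rw [bpt, mul_comm]; exact Complex.norm_exp_ofReal_mul_I t

theorem continuous_bpt : Continuous bpt := by unfold bpt; fun_prop

theorem bpt_eq_circleMap (r t : ℝ) : (r : ℂ) * bpt t = circleMap 0 r t := by
  simp [bpt, circleMap, mul_comm]

theorem norm_smul_bpt {r : ℝ} (hr : 0 ≤ r) (t : ℝ) : ‖(r : ℂ) * bpt t‖ = r := by
  simp [norm_bpt, abs_of_nonneg hr]

theorem smul_bpt_mem_disc {r : ℝ} (hr : 0 ≤ r) (hr1 : r < 1) (t : ℝ) : (r : ℂ) * bpt t ∈ disc := by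
  rw [disc, mem_ball_zero_iff, norm_smul_bpt hr]; exact hr1

theorem bpt_periodic : Function.Periodic bpt (2 * Real.pi) := by
  intro t
  simp only [bpt]
  rw [← Complex.exp_periodic (Complex.I * t)]
  congr 1; push_cast; ring

theorem integral_conj_bpt_pow_mul (m n : ℕ) :
    ∫ t in (0:ℝ)..(2 * Real.pi), (starRingEnd ℂ) (bpt t ^ m) * bpt t ^ n
      = if n = m then ((2 * Real.pi : ℝ) : ℂ) else 0 := by
  have h : ∀ t : ℝ, (starRingEnd ℂ) (bpt t ^ m) * bpt t ^ n
      = Complex.exp ((((n : ℂ) - m) * I) * t) := by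
    intro t
    simp only [bpt, ← Complex.exp_conj, ← Complex.exp_nat_mul, ← Complex.exp_add]
    congr 1
    simp
    ring
  simp only [h]
  split_ifs with hnm
  · subst hnm; simp
  · have h0 : ((n : ℂ) - m) * I ≠ 0 := by
      simp [sub_eq_zero, hnm]
    rw [integral_exp_mul_complex h0]
    have : Complex.exp ((((n : ℂ) - m) * I) * ((2 * Real.pi : ℝ) : ℂ)) = 1 := by
      rw [Complex.exp_eq_one_iff]
      exact ⟨(n : ℤ) - m, by push_cast; ring⟩
    rw [this]; simp

/-- Parseval's identity for an absolutely summable power series on the unit circle. -/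
theorem hasSum_normSq_of_hasSum {c : ℕ → ℂ} (hc : Summable fun n => ‖c n‖) {G : ℝ → ℂ}
    (hG : ∀ t, HasSum (fun n => c n * bpt t ^ n) (G t)) :
    HasSum (fun n => 2 * Real.pi * ‖c n‖ ^ 2) (∫ t in (0:ℝ)..(2 * Real.pi), ‖G t‖ ^ 2) := by
  have hGc : Continuous G := by
    have : G = fun t => ∑' n, c n * bpt t ^ n := funext fun t => (hG t).tsum_eq.symm
    rw [this]
    refine continuous_tsum (fun n => ?_) hc fun n t => ?_
    · have := continuous_bpt; fun_prop
    · simp [norm_bpt]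
  have hmom : ∀ m : ℕ, ∫ t in (0:ℝ)..(2 * Real.pi), (starRingEnd ℂ) (bpt t ^ m) * G t
      = ((2 * Real.pi : ℝ) : ℂ) * c m := by
    intro m
    have h1 := intervalIntegral.hasSum_integral_of_dominated_convergence
      (a := 0) (b := 2 * Real.pi) (μ := volume)
      (F := fun n t => (starRingEnd ℂ) (bpt t ^ m) * (c n * bpt t ^ n))
      (f := fun t => (starRingEnd ℂ) (bpt t ^ m) * G t) (fun n _ => ‖c n‖)
      (fun n => by
        have := continuous_bpt
        exact Continuous.aestronglyMeasurable (by fun_prop))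
      (fun n => by filter_upwards with t _; simp [norm_bpt])
      (by filter_upwards with t _; exact hc) (by simp)
      (by filter_upwards with t _; exact (hG t).mul_left _)
    have h2 : ∀ n, ∫ t in (0:ℝ)..(2 * Real.pi), (starRingEnd ℂ) (bpt t ^ m) * (c n * bpt t ^ n)
        = if n = m then ((2 * Real.pi : ℝ) : ℂ) * c m else 0 := by
      intro n
      have : ∀ t : ℝ, (starRingEnd ℂ) (bpt t ^ m) * (c n * bpt t ^ n)
        = c n * ((starRingEnd ℂ) (bpt t ^ m) * bpt t ^ n) := fun t => by ring
      simp only [this, intervalIntegral.integral_const_mul, integral_conj_bpt_pow_mul]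
      split_ifs with h
      · rw [h, mul_comm]
      · simp
    simp only [h2] at h1
    exact h1.unique (hasSum_ite_eq m _)
  have h1 := intervalIntegral.hasSum_integral_of_dominated_convergence
      (a := 0) (b := 2 * Real.pi) (μ := volume)
      (F := fun n t => (starRingEnd ℂ) (c n) * ((starRingEnd ℂ) (bpt t ^ n) * G t))
      (f := fun t => (starRingEnd ℂ) (G t) * G t) (fun n t => ‖c n‖ * ‖G t‖)
      (fun n => by
        have := continuous_bpt
        exact Continuous.aestronglyMeasurable (by fun_prop))
      (fun n => by filter_upwards with t _; simp [norm_bpt])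
      (by filter_upwards with t _; exact hc.mul_right _)
      (by
        simp only [tsum_mul_right]
        exact Continuous.intervalIntegrable (by fun_prop) _ _)
      (by
        filter_upwards with t _
        have h := ((hG t).map (starRingEnd ℂ) Complex.continuous_conj).mul_right (G t)
        simpa [Function.comp_def, mul_assoc] using h)
  simp only [intervalIntegral.integral_const_mul, hmom] at h1
  have h2 : ∀ t, (starRingEnd ℂ) (G t) * G t = ((‖G t‖ ^ 2 : ℝ) : ℂ) := fun t => by
    rw [Complex.conj_mul']; push_cast; rfl
  have h3 : ∀ n, (starRingEnd ℂ) (c n) * (((2 * Real.pi : ℝ) : ℂ) * c n)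
      = ((2 * Real.pi * ‖c n‖ ^ 2 : ℝ) : ℂ) := fun n => by
    have := Complex.conj_mul' (c n)
    push_cast; linear_combination (2 * (Real.pi : ℂ)) * this
  simp only [h2, h3, intervalIntegral.integral_ofReal] at h1
  exact Complex.hasSum_ofReal.mp h1

/-- The `n`-th Taylor coefficient of `F` at the origin. -/
def taylorCoeff (F : ℂ → ℂ) (n : ℕ) : ℂ := (n.factorial : ℂ)⁻¹ * iteratedDeriv n F 0

theorem hasSum_taylorCoeff {F : ℂ → ℂ} (hF : DifferentiableOn ℂ F disc) {z : ℂ} (hz : z ∈ disc) :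
    HasSum (fun n => taylorCoeff F n * z ^ n) (F z) := by
  have h := Complex.hasSum_taylorSeries_on_ball hF hz
  refine h.congr_fun fun n => ?_
  simp [taylorCoeff]; ring

theorem taylorCoeff_deriv (F : ℂ → ℂ) (n : ℕ) :
    taylorCoeff (deriv F) n = (n + 1) * taylorCoeff F (n + 1) := by
  have : (n : ℂ) + 1 ≠ 0 := by exact_mod_cast n.succ_ne_zero
  simp only [taylorCoeff, ← iteratedDeriv_succ', Nat.factorial_succ]
  push_cast
  field_simp

theorem summable_norm_taylorCoeff {F : ℂ → ℂ} (hF : DifferentiableOn ℂ F disc) {r : ℝ}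
    (hr : 0 ≤ r) (hr1 : r < 1) : Summable fun n => ‖taylorCoeff F n‖ * r ^ n := by
  have hz : (r : ℂ) ∈ disc := by simpa [disc, abs_of_nonneg hr] using hr1
  have := (hasSum_taylorCoeff hF hz).summable.norm
  simpa [abs_of_nonneg hr] using this

theorem hasSum_normSq_taylorCoeff {F : ℂ → ℂ} (hF : DifferentiableOn ℂ F disc) {r : ℝ}
    (hr : 0 ≤ r) (hr1 : r < 1) :
    HasSum (fun n => 2 * Real.pi * (‖taylorCoeff F n‖ * r ^ n) ^ 2)
      (∫ t in (0:ℝ)..(2 * Real.pi), ‖F ((r : ℂ) * bpt t)‖ ^ 2) := by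
  have hs : Summable fun n => ‖taylorCoeff F n * (r : ℂ) ^ n‖ := by
    simpa [abs_of_nonneg hr] using summable_norm_taylorCoeff hF hr hr1
  have h := hasSum_normSq_of_hasSum hs (G := fun t => F ((r : ℂ) * bpt t)) fun t => by
    simpa [mul_pow, mul_assoc] using hasSum_taylorCoeff hF (smul_bpt_mem_disc hr hr1 t)
  simpa [abs_of_nonneg hr] using h

theorem measurableSet_disc : MeasurableSet disc := measurableSet_ball

theorem setLIntegral_periodic {g : ℝ → ℝ≥0∞} (hg : Function.Periodic g (2 * Real.pi)) :
    ∫⁻ t in Ioo (-Real.pi) Real.pi, g t = ∫⁻ t in Ioc 0 (2 * Real.pi), g t := by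
  have h1 := isAddFundamentalDomain_Ioc Real.two_pi_pos (-Real.pi)
  have h2 := isAddFundamentalDomain_Ioc Real.two_pi_pos 0
  have := h1.setLIntegral_eq h2 g (fun x y => by
    obtain ⟨n, hn⟩ := AddSubgroup.mem_zmultiples_iff.mp x.2
    have : (x +ᵥ y : ℝ) = y + n • (2 * Real.pi) := by
      rw [hn, add_comm]; rfl
    rw [this]; exact hg.zsmul n y)
  rw [show -Real.pi + 2 * Real.pi = Real.pi by ring, zero_add] at this
  rw [← this, setLIntegral_congr Ioo_ae_eq_Ioc]

/-- Integration over the disc in polar coordinates. -/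
theorem setLIntegral_disc_polar {G : ℂ → ℝ≥0∞} (hG : Measurable G) :
    ∫⁻ z in disc, G z
      = ∫⁻ r in Ioo (0:ℝ) 1,
        ENNReal.ofReal r * ∫⁻ t in Ioc 0 (2 * Real.pi), G ((r : ℂ) * bpt t) := by
  have hb := continuous_bpt.measurable
  have hpol : ∀ p : ℝ × ℝ, Complex.polarCoord.symm p = (p.1 : ℂ) * bpt p.2 := by
    intro p
    rw [Complex.polarCoord_symm_apply, bpt, mul_comm Complex.I, Complex.exp_mul_I]
    push_cast; rfl
  have hind : Measurable (disc.indicator G) := hG.indicator measurableSet_disc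
  rw [← lintegral_indicator measurableSet_disc, ← Complex.lintegral_comp_polarCoord_symm]
  simp only [hpol, smul_eq_mul, polarCoord_target, Measure.volume_eq_prod]
  rw [setLIntegral_prod]
  swap
  · exact Measurable.aemeasurable (by fun_prop)
  have hinner : ∀ r ∈ Ioi (0:ℝ),
      ∫⁻ t in Ioo (-Real.pi) Real.pi, ENNReal.ofReal r * disc.indicator G ((r : ℂ) * bpt t)
        = (Ioo (0:ℝ) 1).indicator (fun r => ENNReal.ofReal r *
          ∫⁻ t in Ioc 0 (2 * Real.pi), G ((r : ℂ) * bpt t)) r := by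
    intro r hr
    have hr0 : 0 < r := hr
    by_cases hr1 : r < 1
    · rw [indicator_of_mem (show r ∈ Ioo (0:ℝ) 1 from ⟨hr0, hr1⟩)]
      have : ∀ t, disc.indicator G ((r : ℂ) * bpt t) = G ((r : ℂ) * bpt t) := fun t =>
        indicator_of_mem (smul_bpt_mem_disc hr0.le hr1 t) _
      simp only [this]
      rw [lintegral_const_mul _ (by fun_prop)]
      congr 1
      exact setLIntegral_periodic fun t => by simp only [bpt_periodic t]
    · rw [indicator_of_notMem (fun h => hr1 h.2)]
      have : ∀ t, disc.indicator G ((r : ℂ) * bpt t) = 0 := fun t =>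
        indicator_of_notMem (fun h => hr1 (by
          rwa [disc, mem_ball_zero_iff, norm_smul_bpt hr0.le] at h)) _
      simp [this]
  rw [setLIntegral_congr_fun measurableSet_Ioi hinner, setLIntegral_indicator measurableSet_Ioo]
  rw [inter_eq_left.mpr fun r hr => hr.1]

theorem summable_normSq_taylorCoeff {F : ℂ → ℂ} (hF : DifferentiableOn ℂ F disc) {S : ℝ}
    (hS : ∀ r : ℝ, 0 < r → r < 1 →
      ∫ t in (0:ℝ)..(2 * Real.pi), ‖F ((r : ℂ) * bpt t)‖ ^ 2 ≤ S) :
    Summable (fun n => 2 * Real.pi * ‖taylorCoeff F n‖ ^ 2) ∧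
      ∑' n, 2 * Real.pi * ‖taylorCoeff F n‖ ^ 2 ≤ S := by
  have hfin : ∀ s : Finset ℕ, ∑ n ∈ s, 2 * Real.pi * ‖taylorCoeff F n‖ ^ 2 ≤ S := by
    intro s
    have hc : Continuous fun r : ℝ => ∑ n ∈ s, 2 * Real.pi * (‖taylorCoeff F n‖ * r ^ n) ^ 2 := by
      fun_prop
    have ht : Tendsto (fun r : ℝ => ∑ n ∈ s, 2 * Real.pi * (‖taylorCoeff F n‖ * r ^ n) ^ 2)
        (𝓝[<] 1) (𝓝 (∑ n ∈ s, 2 * Real.pi * ‖taylorCoeff F n‖ ^ 2)) := by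
      have := (hc.tendsto 1).mono_left (nhdsWithin_le_nhds (s := Iio 1))
      simpa using this
    refine le_of_tendsto ht ?_
    filter_upwards [Ioo_mem_nhdsLT (zero_lt_one (α := ℝ))] with r hr
    have h := hasSum_normSq_taylorCoeff hF hr.1.le hr.2
    exact (sum_le_hasSum s (fun n _ => by positivity) h).trans (hS r hr.1 hr.2)
  have h0 : ∀ n, 0 ≤ 2 * Real.pi * ‖taylorCoeff F n‖ ^ 2 := fun n => by positivity
  exact ⟨summable_of_sum_le h0 hfin, Real.tsum_le_of_sum_le h0 hfin⟩

theorem integral_normSq_deriv_polar {F : ℂ → ℂ} (hF : DifferentiableOn ℂ F disc) {r : ℝ}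
    (hr : 0 ≤ r) (hr1 : r < 1) :
    ∫⁻ t in Ioc 0 (2 * Real.pi), ENNReal.ofReal (‖deriv F ((r : ℂ) * bpt t)‖ ^ 2)
      = ∑' n, ENNReal.ofReal (2 * Real.pi * (‖taylorCoeff (deriv F) n‖ * r ^ n) ^ 2) := by
  have hF' : DifferentiableOn ℂ (deriv F) disc := hF.deriv isOpen_ball
  have h := hasSum_normSq_taylorCoeff hF' hr hr1
  have hc : Continuous fun t => deriv F ((r : ℂ) * bpt t) :=
    hF'.continuousOn.comp_continuous (by have := continuous_bpt; fun_prop)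
      (fun t => smul_bpt_mem_disc hr hr1 t)
  rw [← ENNReal.ofReal_tsum_of_nonneg (fun n => by positivity) h.summable, h.tsum_eq,
    intervalIntegral.integral_of_le Real.two_pi_pos.le, ofReal_integral_eq_lintegral_ofReal]
  · exact (Continuous.integrableOn_Icc (by fun_prop)).mono_set Ioc_subset_Icc_self
  · exact Eventually.of_forall fun t => by positivity

theorem setLIntegral_radial_weight (n : ℕ) :
    ∫⁻ r in Ioo (0:ℝ) 1, ENNReal.ofReal (r * (1 - r ^ 2) * (r ^ n) ^ 2)
      = ENNReal.ofReal (1 / (2 * (n + 1) * (n + 2))) := by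
  rw [← ofReal_integral_eq_lintegral_ofReal]
  · congr 1
    rw [← integral_Ioc_eq_integral_Ioo, ← intervalIntegral.integral_of_le zero_le_one]
    have : ∀ r : ℝ, r * (1 - r ^ 2) * (r ^ n) ^ 2 = r ^ (2 * n + 1) - r ^ (2 * n + 3) := fun r => by
      ring
    simp only [this]
    rw [intervalIntegral.integral_sub (by simp) (by simp), integral_pow, integral_pow]
    push_cast
    field_simp
    simp
    ring
  · exact (Continuous.integrableOn_Icc (by fun_prop)).mono_set Ioo_subset_Icc_self
  · filter_upwards [ae_restrict_mem measurableSet_Ioo] with r hr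
    have : 0 ≤ 1 - r ^ 2 := by nlinarith [hr.1, hr.2]
    have := hr.1.le
    positivity

/-- The Littlewood–Paley inequality. -/
theorem littlewood_paley {F : ℂ → ℂ} (hF : DifferentiableOn ℂ F disc) {S : ℝ}
    (hS : ∀ r : ℝ, 0 < r → r < 1 →
      ∫ t in (0:ℝ)..(2 * Real.pi), ‖F ((r : ℂ) * bpt t)‖ ^ 2 ≤ S) :
    ∫⁻ z in disc, ENNReal.ofReal (‖deriv F z‖ ^ 2 * (1 - ‖z‖ ^ 2)) ≤ ENNReal.ofReal S := by
  obtain ⟨hsum, hle⟩ := summable_normSq_taylorCoeff hF hS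
  have hmd : Measurable (deriv F) := measurable_deriv F
  rw [setLIntegral_disc_polar (by fun_prop)]
  have hinner : ∀ r ∈ Ioo (0:ℝ) 1, ENNReal.ofReal r * ∫⁻ t in Ioc 0 (2 * Real.pi),
      ENNReal.ofReal (‖deriv F ((r : ℂ) * bpt t)‖ ^ 2 * (1 - ‖(r : ℂ) * bpt t‖ ^ 2))
      = ∑' n, ENNReal.ofReal (2 * Real.pi * ‖taylorCoeff (deriv F) n‖ ^ 2) *
        ENNReal.ofReal (r * (1 - r ^ 2) * (r ^ n) ^ 2) := by
    intro r hr
    have h1 : 0 ≤ 1 - r ^ 2 := by nlinarith [hr.1, hr.2]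
    have h0 := hr.1.le
    have hb := continuous_bpt.measurable
    simp only [norm_smul_bpt h0, ENNReal.ofReal_mul (sq_nonneg ‖_‖)]
    rw [lintegral_mul_const _ (by fun_prop), integral_normSq_deriv_polar hF h0 hr.2,
      mul_comm, mul_assoc, mul_comm, ← ENNReal.tsum_mul_left]
    refine tsum_congr fun n => ?_
    rw [← ENNReal.ofReal_mul h1, ← ENNReal.ofReal_mul (mul_nonneg h1 h0),
      ← ENNReal.ofReal_mul (by positivity)]
    congr 1; ring
  rw [setLIntegral_congr_fun measurableSet_Ioo hinner, lintegral_tsum (fun n => by fun_prop)]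
  have hterm : ∀ n : ℕ, ∫⁻ r in Ioo (0:ℝ) 1,
      ENNReal.ofReal (2 * Real.pi * ‖taylorCoeff (deriv F) n‖ ^ 2) *
        ENNReal.ofReal (r * (1 - r ^ 2) * (r ^ n) ^ 2)
      ≤ ENNReal.ofReal (2 * Real.pi * ‖taylorCoeff F (n + 1)‖ ^ 2) := by
    intro n
    rw [lintegral_const_mul _ (by fun_prop), setLIntegral_radial_weight,
      ← ENNReal.ofReal_mul (by positivity), taylorCoeff_deriv]
    apply ENNReal.ofReal_le_ofReal
    have hn : ‖(n : ℂ) + 1‖ = n + 1 := by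
      have : (n : ℂ) + 1 = ((n + 1 : ℕ) : ℂ) := by push_cast; rfl
      rw [this, Complex.norm_natCast]; push_cast; rfl
    rw [norm_mul, hn, mul_one_div, div_le_iff₀ (by positivity)]
    have : 0 ≤ 2 * Real.pi * ‖taylorCoeff F (n + 1)‖ ^ 2 := by positivity
    have hn0 : (0:ℝ) ≤ n := n.cast_nonneg
    calc 2 * Real.pi * ((n + 1) * ‖taylorCoeff F (n + 1)‖) ^ 2
        = (2 * Real.pi * ‖taylorCoeff F (n + 1)‖ ^ 2) * (n + 1) ^ 2 := by ring
      _ ≤ _ := mul_le_mul_of_nonneg_left (by nlinarith) this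
  calc _ ≤ ∑' n, ENNReal.ofReal (2 * Real.pi * ‖taylorCoeff F (n + 1)‖ ^ 2) :=
        ENNReal.tsum_le_tsum hterm
    _ ≤ ∑' n, ENNReal.ofReal (2 * Real.pi * ‖taylorCoeff F n‖ ^ 2) :=
        ENNReal.tsum_comp_le_tsum_of_injective (add_left_injective 1)
          (fun n => ENNReal.ofReal (2 * Real.pi * ‖taylorCoeff F n‖ ^ 2))
    _ = ENNReal.ofReal (∑' n, 2 * Real.pi * ‖taylorCoeff F n‖ ^ 2) :=
        (ENNReal.ofReal_tsum_of_nonneg (fun n => by positivity) hsum).symm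
    _ ≤ ENNReal.ofReal S := ENNReal.ofReal_le_ofReal hle

theorem integral_poissonKernel {w : ℂ} (hw : w ∈ disc) :
    ∫ t in (0:ℝ)..(2 * Real.pi), (1 - ‖w‖ ^ 2) / ‖bpt t - w‖ ^ 2 = 2 * Real.pi := by
  have h := DiffContOnCl.circleAverage_poissonKernel_smul' (f := fun _ : ℂ => (1 : ℂ))
    (R := 1) (c := 0) (w := w) diffContOnCl_const hw
  rw [Real.circleAverage_def] at h
  have hpi := Real.two_pi_pos
  simp only [← bpt_eq_circleMap, sub_zero, Complex.ofReal_one, one_mul, norm_bpt,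
    Complex.real_smul, mul_one, one_pow, intervalIntegral.integral_ofReal] at h
  rw [← Complex.ofReal_mul, Complex.ofReal_eq_one, inv_mul_eq_one₀ hpi.ne'] at h
  exact h.symm

theorem norm_one_sub_conj_mul {a : ℂ} (ha : ‖a‖ = 1) (z : ℂ) :
    ‖1 - (starRingEnd ℂ) a * z‖ = ‖a - z‖ := by
  have h : 1 - (starRingEnd ℂ) a * z = (starRingEnd ℂ) a * (a - z) := by
    rw [mul_sub, Complex.conj_mul', ha]; simp
  rw [h, norm_mul, Complex.norm_conj, ha, one_mul]

theorem norm_sub_smul_comm {a b : ℂ} (ha : ‖a‖ = 1) (hb : ‖b‖ = 1) (r : ℝ) :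
    ‖a - (r : ℂ) * b‖ = ‖b - (r : ℂ) * a‖ := by
  rw [← norm_one_sub_conj_mul ha, ← norm_one_sub_conj_mul hb, ← Complex.norm_conj]
  congr 1
  simp; ring

theorem ae_norm_eq_one {μ : Measure ℂ} (hμ : OnCircle μ) : ∀ᵐ a ∂μ, ‖a‖ = 1 := by
  have : ∀ᵐ a ∂μ, a ∈ circleT := hμ
  filter_upwards [this] with a ha
  simpa [circleT] using ha

theorem one_sub_normSq_nonneg {z : ℂ} (hz : z ∈ disc) : 0 ≤ 1 - ‖z‖ ^ 2 := by
  have : ‖z‖ < 1 := by simpa [disc] using hz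
  nlinarith [norm_nonneg z]

theorem poissonMu_nonneg (μ : Measure ℂ) {z : ℂ} (hz : z ∈ disc) : 0 ≤ poissonMu μ z :=
  integral_nonneg fun _ => div_nonneg (one_sub_normSq_nonneg hz) (sq_nonneg _)

theorem measurable_poissonMu (μ : Measure ℂ) [IsFiniteMeasure μ] : Measurable (poissonMu μ) := by
  refine (StronglyMeasurable.integral_prod_right' (ν := μ) (f := fun p : ℂ × ℂ =>
    (1 - ‖p.1‖ ^ 2) / ‖1 - (starRingEnd ℂ) p.2 * p.1‖ ^ 2) ?_).measurable
  have h : Measurable (starRingEnd ℂ : ℂ → ℂ) := Complex.continuous_conj.measurable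
  exact Measurable.stronglyMeasurable (by fun_prop)

theorem poissonMu_le_of_measure_ball {μ : Measure ℂ} [IsFiniteMeasure μ] (hμ : OnCircle μ)
    {ζ : ℂ} {ρ : ℝ} (hρ : 0 < ρ) (h0 : μ (ball ζ ρ) = 0) {z : ℂ} (hz : z ∈ disc)
    (hzζ : ‖z - ζ‖ ≤ ρ / 2) :
    poissonMu μ z ≤ (μ.real univ * (4 / ρ ^ 2)) * (1 - ‖z‖ ^ 2) := by
  have h1 := one_sub_normSq_nonneg hz
  have hae : ∀ᵐ a ∂μ, a ∉ ball ζ ρ := measure_eq_zero_iff_ae_notMem.mp h0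
  have : poissonMu μ z ≤ ∫ _, (4 / ρ ^ 2) * (1 - ‖z‖ ^ 2) ∂μ := by
    refine integral_mono_of_nonneg (Eventually.of_forall fun a => ?_) (integrable_const _) ?_
    · exact div_nonneg h1 (sq_nonneg _)
    · filter_upwards [hae, ae_norm_eq_one hμ] with a ha hn
      have h2 : ρ ≤ ‖a - ζ‖ := by simpa [dist_eq_norm] using ha
      have h3 : ρ / 2 ≤ ‖a - z‖ := by
        have := norm_sub_le_norm_sub_add_norm_sub a z ζ
        linarith
      have h4 : 0 < ‖a - z‖ := by linarith
      rw [norm_one_sub_conj_mul hn, div_mul_eq_mul_div, div_le_div_iff₀ (by positivity)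
        (by positivity)]
      nlinarith [mul_le_mul_of_nonneg_left (pow_le_pow_left₀ (by positivity) h3 2) h1]
  simpa [mul_assoc] using this

theorem integrableOn_poissonMu (μ : Measure ℂ) [IsFiniteMeasure μ] (hμ : OnCircle μ) :
    IntegrableOn (poissonMu μ) disc := by
  have hm := measurable_poissonMu μ
  refine ⟨hm.aestronglyMeasurable, ?_⟩
  rw [HasFiniteIntegral, setLIntegral_disc_polar (by fun_prop)]
  have hconj : Measurable (starRingEnd ℂ : ℂ → ℂ) := Complex.continuous_conj.measurable
  have hb := continuous_bpt.measurable
  have hinner : ∀ r ∈ Ioo (0:ℝ) 1, ENNReal.ofReal r *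
      ∫⁻ t in Ioc 0 (2 * Real.pi), ‖poissonMu μ ((r : ℂ) * bpt t)‖ₑ
      ≤ ENNReal.ofReal (2 * Real.pi) * μ univ := by
    intro r hr
    have h1 : ENNReal.ofReal r ≤ 1 := by simpa using hr.2.le
    refine (mul_le_mul_left h1 _).trans ?_
    rw [one_mul]
    calc _ ≤ ∫⁻ t : ℝ in Ioc 0 (2 * Real.pi), ∫⁻ a : ℂ, ‖(1 - ‖(r : ℂ) * bpt t‖ ^ 2) /
          ‖1 - (starRingEnd ℂ) a * ((r : ℂ) * bpt t)‖ ^ 2‖ₑ ∂μ :=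
          lintegral_mono fun t => enorm_integral_le_lintegral_enorm _
      _ = ∫⁻ a : ℂ, (∫⁻ t in Ioc (0:ℝ) (2 * Real.pi), ‖(1 - ‖(r : ℂ) * bpt t‖ ^ 2) /
          ‖1 - (starRingEnd ℂ) a * ((r : ℂ) * bpt t)‖ ^ 2‖ₑ) ∂μ := by
          rw [lintegral_lintegral_swap]
          exact Measurable.aemeasurable (by fun_prop)
      _ ≤ ∫⁻ a, ENNReal.ofReal (2 * Real.pi) ∂μ := by
          refine lintegral_mono_ae ?_
          filter_upwards [ae_norm_eq_one hμ] with a ha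
          have hw : (r : ℂ) * a ∈ disc := by
            simpa [disc, ha, abs_of_pos hr.1] using hr.2
          have hna : ‖(r : ℂ) * a‖ = r := by simp [ha, abs_of_pos hr.1]
          have hI := congrArg ENNReal.ofReal (integral_poissonKernel hw)
          rw [intervalIntegral.integral_of_le Real.two_pi_pos.le,
            ofReal_integral_eq_lintegral_ofReal] at hI
          · rw [← hI]
            refine lintegral_mono fun t => ?_
            have hn : 0 ≤ (1 - ‖(r : ℂ) * a‖ ^ 2) / ‖bpt t - (r : ℂ) * a‖ ^ 2 :=
              div_nonneg (one_sub_normSq_nonneg hw) (sq_nonneg _)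
            rw [norm_one_sub_conj_mul ha, norm_smul_bpt hr.1.le,
              norm_sub_smul_comm ha (norm_bpt t), hna] at *
            rw [Real.enorm_eq_ofReal hn]
          · refine (Continuous.integrableOn_Icc ?_).mono_set Ioc_subset_Icc_self
            have := continuous_bpt
            refine Continuous.div (by fun_prop) (by fun_prop) fun t h0 => ?_
            have h2 : bpt t = (r : ℂ) * a := by
              simpa [sub_eq_zero] using h0
            have h3 := norm_bpt t
            rw [h2, hna] at h3
            linarith [hr.2]
          · exact Eventually.of_forall fun t =>
              div_nonneg (one_sub_normSq_nonneg hw) (sq_nonneg _)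
      _ = _ := by simp
  calc _ ≤ ∫⁻ r in Ioo (0:ℝ) 1, ENNReal.ofReal (2 * Real.pi) * μ univ :=
        setLIntegral_mono measurable_const hinner
    _ < ⊤ := by
        simp [ENNReal.mul_lt_top, measure_lt_top]

/-- The part of the disc near a point off the support of `μ` only contributes the Hardy norm to
the Dirichlet-type norm of `f * k`; elsewhere uniform bounds on `k` and its derivative suffice. -/
structure SmallAt (f : ℂ → ℂ) (ζ : ℂ) (δ ε : ℝ) (k : ℂ → ℂ) : Prop where
  diff : DifferentiableOn ℂ k disc
  bound : ∀ z ∈ disc, δ ≤ ‖z - ζ‖ → ‖k z‖ ≤ ε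
  bound_deriv : ∀ z ∈ disc, δ ≤ ‖z - ζ‖ → ‖deriv k z‖ ≤ ε
  mean : ∀ r : ℝ, 0 < r → r < 1 →
    ∫ t in (0:ℝ)..(2 * Real.pi), ‖f ((r : ℂ) * bpt t) * k ((r : ℂ) * bpt t)‖ ^ 2 ≤ ε ^ 2

theorem continuous_smul_bpt {F : ℂ → ℂ} (hF : DifferentiableOn ℂ F disc) {r : ℝ}
    (hr : 0 ≤ r) (hr1 : r < 1) : Continuous fun t => F ((r : ℂ) * bpt t) :=
  hF.continuousOn.comp_continuous (by have := continuous_bpt; fun_prop)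
    (fun t => smul_bpt_mem_disc hr hr1 t)

theorem SmallAt.add {f k₁ k₂ : ℂ → ℂ} {ζ : ℂ} {δ ε₁ ε₂ : ℝ} (hf : DifferentiableOn ℂ f disc)
    (h₁ : SmallAt f ζ δ ε₁ k₁) (h₂ : SmallAt f ζ δ ε₂ k₂) (hε₁ : 0 ≤ ε₁) (hε₂ : 0 ≤ ε₂) :
    SmallAt f ζ δ (2 * (ε₁ + ε₂)) (fun z => k₁ z + k₂ z) where
  diff := h₁.diff.add h₂.diff
  bound z hz hd := by
    have := norm_add_le (k₁ z) (k₂ z)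
    linarith [h₁.bound z hz hd, h₂.bound z hz hd]
  bound_deriv z hz hd := by
    have hn : disc ∈ 𝓝 z := isOpen_ball.mem_nhds hz
    rw [deriv_fun_add (h₁.diff.differentiableAt hn) (h₂.diff.differentiableAt hn)]
    have := norm_add_le (deriv k₁ z) (deriv k₂ z)
    linarith [h₁.bound_deriv z hz hd, h₂.bound_deriv z hz hd]
  mean r hr hr1 := by
    have c0 := continuous_smul_bpt hf hr.le hr1
    have c1 := continuous_smul_bpt h₁.diff hr.le hr1
    have c2 := continuous_smul_bpt h₂.diff hr.le hr1
    have i1 : IntervalIntegrable (fun t => 2 * ‖f ((r : ℂ) * bpt t) * k₁ ((r : ℂ) * bpt t)‖ ^ 2)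
      volume 0 (2 * Real.pi) :=
        Continuous.intervalIntegrable (continuous_const.mul ((c0.mul c1).norm.pow 2)) _ _
    have i2 : IntervalIntegrable (fun t => 2 * ‖f ((r : ℂ) * bpt t) * k₂ ((r : ℂ) * bpt t)‖ ^ 2)
      volume 0 (2 * Real.pi) :=
        Continuous.intervalIntegrable (continuous_const.mul ((c0.mul c2).norm.pow 2)) _ _
    have i3 : IntervalIntegrable (fun t => ‖f ((r : ℂ) * bpt t) *
      (k₁ ((r : ℂ) * bpt t) + k₂ ((r : ℂ) * bpt t))‖ ^ 2)
      volume 0 (2 * Real.pi) := Continuous.intervalIntegrable ((c0.mul (c1.add c2)).norm.pow 2) _ _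
    have := intervalIntegral.integral_mono_on Real.two_pi_pos.le i3 (i1.add i2) fun t _ => by
      have := norm_add_le (f ((r : ℂ) * bpt t) * k₁ ((r : ℂ) * bpt t))
        (f ((r : ℂ) * bpt t) * k₂ ((r : ℂ) * bpt t))
      rw [mul_add]
      have h5 := pow_le_pow_left₀ (norm_nonneg _) this 2
      nlinarith [sq_nonneg (‖f ((r : ℂ) * bpt t) * k₁ ((r : ℂ) * bpt t)‖ -
        ‖f ((r : ℂ) * bpt t) * k₂ ((r : ℂ) * bpt t)‖)]
    rw [intervalIntegral.integral_add i1 i2, intervalIntegral.integral_const_mul,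
      intervalIntegral.integral_const_mul] at this
    nlinarith [h₁.mean r hr hr1, h₂.mean r hr hr1, mul_nonneg hε₁ hε₂]

theorem hardyNormSq_le {F : ℂ → ℂ} {S : ℝ} (hS : ∀ r : ℝ, 0 < r → r < 1 →
      ∫ t in (0:ℝ)..(2 * Real.pi), ‖F ((r : ℂ) * bpt t)‖ ^ 2 ≤ S) :
    BddAbove (hardySet F) ∧ hardyNormSq F ≤ S := by
  have hub : ∀ x ∈ hardySet F, x ≤ S := by
    rintro x ⟨r, hr, hr1, rfl⟩
    have h1 : 1 / (2 * Real.pi) ≤ 1 := by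
      rw [div_le_one Real.two_pi_pos]; linarith [Real.pi_gt_three]
    have h2 : 0 ≤ ∫ t in (0:ℝ)..(2 * Real.pi), ‖F ((r : ℂ) * bpt t)‖ ^ 2 :=
      intervalIntegral.integral_nonneg Real.two_pi_pos.le fun _ _ => sq_nonneg _
    exact (mul_le_of_le_one_left h2 h1).trans (hS r hr hr1)
  exact ⟨⟨S, hub⟩, csSup_le ⟨_, 1 / 2, by norm_num, by norm_num, rfl⟩ hub⟩

theorem SmallAt.dNormSq_mul_le {μ : Measure ℂ} [IsFiniteMeasure μ] (hμ : OnCircle μ)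
    {f : ℂ → ℂ} (hfD : MemD μ f) {M : ℝ} (hM : ∀ z ∈ disc, ‖f z‖ ≤ M)
    {ζ : ℂ} {δ : ℝ} (hδ : 0 < δ) (h0 : μ (ball ζ (2 * δ)) = 0) :
    ∃ K : ℝ, ∀ (k : ℂ → ℂ) (ε : ℝ), SmallAt f ζ δ ε k →
      MemD μ (fun z => f z * k z) ∧ dNormSq μ (fun z => f z * k z) ≤ K * ε ^ 2 := by
  set C := μ.real univ * (4 / (2 * δ) ^ 2) with hC
  have hC0 : 0 ≤ C := by positivity
  refine ⟨1 + 1 / Real.pi * ((2 * ∫ z in disc, dirichletDensity μ f z) +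
    (2 * M ^ 2 * ∫ z in disc, poissonMu μ z) + C), fun k ε hk => ?_⟩
  have hfd : DifferentiableOn ℂ f disc := hfD.1.1
  have hFd : DifferentiableOn ℂ (fun z => f z * k z) disc := hfd.mul hk.diff
  obtain ⟨hbdd, hle⟩ := hardyNormSq_le (F := fun z => f z * k z) hk.mean
  set F := fun z => f z * k z with hFdef
  have hLP := littlewood_paley hFd hk.mean
  have hmd : Measurable (deriv F) := measurable_deriv F
  have hLPnn : ∀ᵐ z ∂volume.restrict disc, 0 ≤ ‖deriv F z‖ ^ 2 * (1 - ‖z‖ ^ 2) := by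
    filter_upwards [ae_restrict_mem measurableSet_disc] with z hz
    exact mul_nonneg (sq_nonneg _) (one_sub_normSq_nonneg hz)
  have hLPi : IntegrableOn (fun z => ‖deriv F z‖ ^ 2 * (1 - ‖z‖ ^ 2)) disc := by
    refine ⟨Measurable.aestronglyMeasurable (by fun_prop), ?_⟩
    rw [hasFiniteIntegral_iff_ofReal hLPnn]
    exact hLP.trans_lt ENNReal.ofReal_lt_top
  have hLPle : ∫ z in disc, ‖deriv F z‖ ^ 2 * (1 - ‖z‖ ^ 2) ≤ ε ^ 2 := by
    rw [integral_eq_lintegral_of_nonneg_ae hLPnn (Measurable.aestronglyMeasurable (by fun_prop))]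
    exact ENNReal.toReal_le_of_le_ofReal (sq_nonneg _) hLP
  have hpoint : ∀ z ∈ disc, dirichletDensity μ F z ≤ 2 * ε ^ 2 * dirichletDensity μ f z +
      2 * M ^ 2 * ε ^ 2 * poissonMu μ z + C * (‖deriv F z‖ ^ 2 * (1 - ‖z‖ ^ 2)) := by
    intro z hz
    have hP := poissonMu_nonneg μ hz
    have h1 := one_sub_normSq_nonneg hz
    by_cases hzδ : δ ≤ ‖z - ζ‖
    · have hn : disc ∈ 𝓝 z := isOpen_ball.mem_nhds hz
      have hd : deriv F z = deriv f z * k z + f z * deriv k z :=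
        deriv_fun_mul (hfd.differentiableAt hn) (hk.diff.differentiableAt hn)
      have hb := hk.bound z hz hzδ
      have hb' := hk.bound_deriv z hz hzδ
      have e1 : ‖deriv F z‖ ≤ ‖deriv f z‖ * ε + M * ε := by
        rw [hd]
        refine (norm_add_le _ _).trans ?_
        rw [norm_mul, norm_mul]
        have := (norm_nonneg _).trans (hM z hz)
        have := hM z hz
        gcongr
      have e2 : ‖deriv F z‖ ^ 2 ≤ 2 * ε ^ 2 * ‖deriv f z‖ ^ 2 + 2 * M ^ 2 * ε ^ 2 := by
        have := pow_le_pow_left₀ (norm_nonneg _) e1 2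
        nlinarith [sq_nonneg (‖deriv f z‖ * ε - M * ε)]
      have e3 := mul_le_mul_of_nonneg_right e2 hP
      have e4 : 0 ≤ C * (‖deriv F z‖ ^ 2 * (1 - ‖z‖ ^ 2)) := by positivity
      simp only [dirichletDensity]
      nlinarith
    · have e1 := poissonMu_le_of_measure_ball hμ (by positivity : 0 < 2 * δ) h0 hz
        (by linarith [not_le.mp hzδ])
      have e2 := mul_le_mul_of_nonneg_left e1 (sq_nonneg ‖deriv F z‖)
      have e3 : 0 ≤ 2 * ε ^ 2 * dirichletDensity μ f z := by
        unfold dirichletDensity; positivity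
      have e4 : 0 ≤ 2 * M ^ 2 * ε ^ 2 * poissonMu μ z := by positivity
      have e5 : dirichletDensity μ F z ≤ C * (‖deriv F z‖ ^ 2 * (1 - ‖z‖ ^ 2)) := by
        rw [dirichletDensity, hC]; linarith
      linarith
  have hi1 : IntegrableOn (fun z => 2 * ε ^ 2 * dirichletDensity μ f z) disc :=
    hfD.2.const_mul _
  have hi2 : IntegrableOn (fun z => 2 * M ^ 2 * ε ^ 2 * poissonMu μ z) disc :=
    (integrableOn_poissonMu μ hμ).const_mul _
  have hi3 : IntegrableOn (fun z => C * (‖deriv F z‖ ^ 2 * (1 - ‖z‖ ^ 2))) disc :=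
    hLPi.const_mul _
  have hmP := measurable_poissonMu μ
  have hint : IntegrableOn (dirichletDensity μ F) disc := by
    refine Integrable.mono' ((hi1.add hi2).add hi3)
      (Measurable.aestronglyMeasurable (by unfold dirichletDensity; fun_prop)) ?_
    filter_upwards [ae_restrict_mem measurableSet_disc] with z hz
    rw [dirichletDensity, Real.norm_of_nonneg (mul_nonneg (sq_nonneg _) (poissonMu_nonneg μ hz))]
    exact hpoint z hz
  refine ⟨⟨⟨hFd, hbdd⟩, hint⟩, ?_⟩
  have hmono := setIntegral_mono_on hint ((hi1.add hi2).add hi3) measurableSet_disc hpoint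
  rw [integral_add' (hi1.add hi2) hi3, integral_add' hi1 hi2, integral_const_mul,
    integral_const_mul, integral_const_mul] at hmono
  have hCle := mul_le_mul_of_nonneg_left hLPle hC0
  have hfin : ∫ z in disc, dirichletDensity μ F z ≤ ((2 * ∫ z in disc, dirichletDensity μ f z) +
    (2 * M ^ 2 * ∫ z in disc, poissonMu μ z) + C) * ε ^ 2 := by linarith
  have := mul_le_mul_of_nonneg_left hfin (by positivity : 0 ≤ 1 / Real.pi)
  rw [dNormSq, dirichletIntegral]
  linarith

/-- The Herglotz integral of a function on the circle. -/
def herg (w : ℝ → ℝ) (z : ℂ) : ℂ :=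
  ((2 * Real.pi : ℝ) : ℂ)⁻¹ * ∫ t, ((bpt t + z) / (bpt t - z)) * (w t : ℂ) ∂θm

instance isFiniteMeasure_θm : IsFiniteMeasure θm := by unfold θm; infer_instance

theorem one_sub_le_norm_bpt_sub (t : ℝ) (z : ℂ) : 1 - ‖z‖ ≤ ‖bpt t - z‖ := by
  have := norm_sub_norm_le (bpt t) z
  rwa [norm_bpt] at this

theorem norm_kernel_mul_le {w : ℝ → ℝ} {z : ℂ} {d : ℝ} (hd : 0 < d)
    (h : ∀ t, w t ≠ 0 → d ≤ ‖bpt t - z‖) (t : ℝ) :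
    ‖((bpt t + z) / (bpt t - z)) * (w t : ℂ)‖ ≤ (1 + ‖z‖) / d * ‖w t‖ := by
  by_cases hw : w t = 0
  · simp [hw]
  have h1 : ‖bpt t + z‖ ≤ 1 + ‖z‖ := by
    have := norm_add_le (bpt t) z
    rwa [norm_bpt] at this
  rw [norm_mul, norm_div, Complex.norm_real]
  gcongr
  exact h t hw

theorem measurable_bpt : Measurable bpt := continuous_bpt.measurable

theorem integrable_kernel_mul {w : ℝ → ℝ} (hw : Integrable w θm) {z : ℂ} {d : ℝ} (hd : 0 < d)
    (h : ∀ t, w t ≠ 0 → d ≤ ‖bpt t - z‖) :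
    Integrable (fun t => ((bpt t + z) / (bpt t - z)) * (w t : ℂ)) θm := by
  have hb := measurable_bpt
  refine Integrable.mono' (hw.norm.const_mul ((1 + ‖z‖) / d)) ?_
    (Eventually.of_forall (norm_kernel_mul_le hd h))
  exact (Measurable.aestronglyMeasurable (by fun_prop)).mul hw.ofReal.aestronglyMeasurable

theorem integrable_kernel_mul_of_mem_disc {w : ℝ → ℝ} (hw : Integrable w θm) {z : ℂ}
    (hz : z ∈ disc) : Integrable (fun t => ((bpt t + z) / (bpt t - z)) * (w t : ℂ)) θm := by
  have hz' : ‖z‖ < 1 := by simpa [disc] using hz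
  exact integrable_kernel_mul hw (sub_pos.2 hz') fun t _ => one_sub_le_norm_bpt_sub t z

theorem inv_two_pi_le_one : (2 * Real.pi)⁻¹ ≤ 1 :=
  inv_le_one_of_one_le₀ (by linarith [Real.pi_gt_three])

theorem norm_herg_le {w : ℝ → ℝ} (hw : Integrable w θm) {z : ℂ} {d : ℝ} (hd : 0 < d)
    (h : ∀ t, w t ≠ 0 → d ≤ ‖bpt t - z‖) (hz : ‖z‖ ≤ 1) :
    ‖herg w z‖ ≤ 2 / d * ∫ t, ‖w t‖ ∂θm := by
  have h1 : ‖∫ t, ((bpt t + z) / (bpt t - z)) * (w t : ℂ) ∂θm‖ ≤ 2 / d * ∫ t, ‖w t‖ ∂θm := by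
    have h2 : (1 + ‖z‖) / d * ∫ t, ‖w t‖ ∂θm ≤ 2 / d * ∫ t, ‖w t‖ ∂θm := by
      have := integral_nonneg (μ := θm) (f := fun t => ‖w t‖) fun t => norm_nonneg _
      gcongr
      linarith
    refine le_trans ?_ h2
    rw [← integral_const_mul]
    exact norm_integral_le_of_norm_le (hw.norm.const_mul _)
      (Eventually.of_forall (norm_kernel_mul_le hd h))
  rw [herg, norm_mul, norm_inv, Complex.norm_real, Real.norm_of_nonneg Real.two_pi_pos.le]
  exact (mul_le_of_le_one_left (norm_nonneg _) inv_two_pi_le_one).trans h1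

theorem hasDerivAt_herg {w : ℝ → ℝ} (hw : Integrable w θm) {z : ℂ} {d : ℝ} (hd : 0 < d)
    (h : ∀ t, w t ≠ 0 → d ≤ ‖bpt t - z‖) :
    HasDerivAt (herg w) (((2 * Real.pi : ℝ) : ℂ)⁻¹ *
      ∫ t, (2 * bpt t / (bpt t - z) ^ 2) * (w t : ℂ) ∂θm) z := by
  have hb := measurable_bpt
  have hwm : AEStronglyMeasurable (fun t => (w t : ℂ)) θm := hw.ofReal.aestronglyMeasurable
  refine HasDerivAt.const_mul _ ?_
  have hd2 : 0 < d / 2 := by positivity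
  have haway : ∀ x ∈ ball z (d / 2), ∀ t, w t ≠ 0 → d / 2 ≤ ‖bpt t - x‖ := by
    intro x hx t ht
    have h1 := h t ht
    have h2 : ‖x - z‖ < d / 2 := by simpa [dist_eq_norm] using hx
    have h3 := norm_sub_le_norm_sub_add_norm_sub (bpt t) x z
    linarith
  refine (hasDerivAt_integral_of_dominated_loc_of_deriv_le
    (F' := fun x t => (2 * bpt t / (bpt t - x) ^ 2) * (w t : ℂ))
    (bound := fun t => 2 / (d / 2) ^ 2 * ‖w t‖) (ball_mem_nhds z hd2) ?_ ?_ ?_ ?_ ?_ ?_).2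
  · exact Eventually.of_forall fun x =>
      (Measurable.aestronglyMeasurable (by fun_prop)).mul hwm
  · exact integrable_kernel_mul hw hd h
  · exact (Measurable.aestronglyMeasurable (by fun_prop)).mul hwm
  · refine Eventually.of_forall fun t x hx => ?_
    by_cases ht : w t = 0
    · simp [ht]
    have := haway x hx t ht
    rw [norm_mul, norm_div, norm_mul, norm_pow, norm_bpt, Complex.norm_real]
    simp only [Complex.norm_ofNat, mul_one]
    gcongr
  · exact hw.norm.const_mul _
  · refine Eventually.of_forall fun t x hx => ?_
    by_cases ht : w t = 0
    · simpa [ht] using hasDerivAt_const x (0 : ℂ)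
    have h1 := haway x hx t ht
    have h2 : bpt t - x ≠ 0 := norm_pos_iff.1 (hd2.trans_le h1)
    refine HasDerivAt.mul_const ?_ _
    convert ((hasDerivAt_id' x).const_add (bpt t)).div ((hasDerivAt_id' x).const_sub (bpt t)) h2
      using 1
    congr 1
    ring

theorem norm_deriv_herg_le {w : ℝ → ℝ} (hw : Integrable w θm) {z : ℂ} {d : ℝ} (hd : 0 < d)
    (h : ∀ t, w t ≠ 0 → d ≤ ‖bpt t - z‖) :
    ‖deriv (herg w) z‖ ≤ 2 / d ^ 2 * ∫ t, ‖w t‖ ∂θm := by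
  rw [(hasDerivAt_herg hw hd h).deriv]
  have h1 : ‖∫ t, (2 * bpt t / (bpt t - z) ^ 2) * (w t : ℂ) ∂θm‖
      ≤ 2 / d ^ 2 * ∫ t, ‖w t‖ ∂θm := by
    rw [← integral_const_mul]
    refine norm_integral_le_of_norm_le (hw.norm.const_mul _) (Eventually.of_forall fun t => ?_)
    by_cases ht : w t = 0
    · simp [ht]
    rw [norm_mul, norm_div, norm_mul, norm_pow, norm_bpt, Complex.norm_real]
    simp only [Complex.norm_ofNat, mul_one]
    have := h t ht
    gcongr
  rw [norm_mul, norm_inv, Complex.norm_real, Real.norm_of_nonneg Real.two_pi_pos.le]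
  exact (mul_le_of_le_one_left (norm_nonneg _) inv_two_pi_le_one).trans h1

theorem differentiableOn_herg {w : ℝ → ℝ} (hw : Integrable w θm) :
    DifferentiableOn ℂ (herg w) disc := fun z hz => by
  have hz' : ‖z‖ < 1 := by simpa [disc] using hz
  exact (hasDerivAt_herg hw (sub_pos.2 hz') fun t _ =>
    one_sub_le_norm_bpt_sub t z).differentiableAt.differentiableWithinAt

theorem herg_sub {w₁ w₂ : ℝ → ℝ} (h₁ : Integrable w₁ θm) (h₂ : Integrable w₂ θm) {z : ℂ}
    (hz : z ∈ disc) : herg (w₁ - w₂) z = herg w₁ z - herg w₂ z := by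
  simp only [herg, ← mul_sub]
  rw [← integral_sub (integrable_kernel_mul_of_mem_disc h₁ hz)
    (integrable_kernel_mul_of_mem_disc h₂ hz)]
  simp [mul_sub]

theorem herg_zero (w : ℝ → ℝ) : herg w 0 = (((2 * Real.pi)⁻¹ * ∫ t, w t ∂θm : ℝ) : ℂ) := by
  have hb : ∀ t, bpt t ≠ 0 := fun t => norm_pos_iff.1 (by simp [norm_bpt])
  simp [herg, hb, integral_complex_ofReal]

theorem kernel_re (t : ℝ) (z : ℂ) :
    ((bpt t + z) / (bpt t - z)).re = (1 - ‖z‖ ^ 2) / ‖bpt t - z‖ ^ 2 := by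
  have h1 : ‖bpt t‖ ^ 2 = 1 := by rw [norm_bpt, one_pow]
  rw [← h1, ← Complex.normSq_eq_norm_sq, ← Complex.normSq_eq_norm_sq, ← Complex.normSq_eq_norm_sq,
    Complex.div_re, ← add_div]
  congr 1
  simp only [Complex.normSq_apply, add_re, sub_re, add_im, sub_im]
  ring

theorem re_herg {w : ℝ → ℝ} (hw : Integrable w θm) {z : ℂ} (hz : z ∈ disc) :
    (herg w z).re = (2 * Real.pi)⁻¹ * ∫ t, (1 - ‖z‖ ^ 2) / ‖bpt t - z‖ ^ 2 * w t ∂θm := by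
  rw [herg, ← Complex.ofReal_inv, Complex.re_ofReal_mul]
  congr 1
  have := integral_re (𝕜 := ℂ) (integrable_kernel_mul_of_mem_disc hw hz)
  simp only [RCLike.re_eq_complex_re] at this
  rw [← this]
  simp [kernel_re]

theorem integrable_poisson_mul {w : ℝ → ℝ} (hw : Integrable w θm) {z : ℂ} (hz : z ∈ disc) :
    Integrable (fun t => (1 - ‖z‖ ^ 2) / ‖bpt t - z‖ ^ 2 * w t) θm := by
  have := (integrable_kernel_mul_of_mem_disc hw hz).re
  simpa [Complex.re_mul_ofReal, kernel_re] using this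

theorem integral_poisson {z : ℂ} (hz : z ∈ disc) :
    ∫ t, (1 - ‖z‖ ^ 2) / ‖bpt t - z‖ ^ 2 ∂θm = 2 * Real.pi := by
  rw [← integral_poissonKernel hz, intervalIntegral.integral_of_le Real.two_pi_pos.le, θm]

theorem integrable_poisson {z : ℂ} (hz : z ∈ disc) :
    Integrable (fun t => (1 - ‖z‖ ^ 2) / ‖bpt t - z‖ ^ 2) θm := by
  simpa using integrable_poisson_mul (integrable_const (1 : ℝ)) hz

theorem re_herg_le {w : ℝ → ℝ} (hw : Integrable w θm) {c : ℝ} (hc : ∀ᵐ t ∂θm, w t ≤ c) {z : ℂ}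
    (hz : z ∈ disc) : (herg w z).re ≤ c := by
  rw [re_herg hw hz, inv_mul_le_iff₀ Real.two_pi_pos, ← integral_poisson hz,
    ← integral_mul_const]
  refine integral_mono_ae (integrable_poisson_mul hw hz) ((integrable_poisson hz).mul_const c) ?_
  filter_upwards [hc] with t ht
  exact mul_le_mul_of_nonneg_left ht (div_nonneg (one_sub_normSq_nonneg hz) (sq_nonneg _))

theorem abs_poisson_sub_le {Ψ : ℂ → ℝ} {K : ℝ} (hK : 0 ≤ K)
    (hΨ : ∀ x y, |Ψ x - Ψ y| ≤ K * ‖x - y‖) (hΨm : Measurable Ψ) (s : ℝ) {r : ℝ} (hr : 0 < r)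
    (hr1 : r < 1) :
    |(∫ t, (1 - r ^ 2) / ‖bpt t - (r : ℂ) * bpt s‖ ^ 2 * Ψ (bpt t) ∂θm) - 2 * Real.pi * Ψ (bpt s)|
      ≤ 5 * Real.pi * K * √(1 - r ^ 2) := by
  have hz := smul_bpt_mem_disc hr.le hr1 s
  have hnz := norm_smul_bpt hr.le s
  have hpos : 0 < 1 - r ^ 2 := by nlinarith
  set e := √(1 - r ^ 2) with he
  have he0 : 0 < e := Real.sqrt_pos.2 hpos
  have hee : e ^ 2 = 1 - r ^ 2 := Real.sq_sqrt hpos.le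
  have hk := integrable_poisson hz
  have hI := integral_poisson hz
  rw [hnz] at hk hI
  have hb := measurable_bpt
  have hdiff : ∀ t, ‖(1 - r ^ 2) / ‖bpt t - (r : ℂ) * bpt s‖ ^ 2 * (Ψ (bpt t) - Ψ (bpt s))‖
      ≤ K / 2 * e * ((1 - r ^ 2) / ‖bpt t - (r : ℂ) * bpt s‖ ^ 2) + 2 * K * e := by
    intro t
    set D := ‖bpt t - (r : ℂ) * bpt s‖ with hD
    have hD1 : 1 - r ≤ D := by
      have := one_sub_le_norm_bpt_sub t ((r : ℂ) * bpt s)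
      rwa [hnz] at this
    have hD0 : 0 < D := by linarith
    have hab : ‖bpt t - bpt s‖ ≤ 2 * D := by
      have h1 := norm_sub_le_norm_sub_add_norm_sub (bpt t) ((r : ℂ) * bpt s) (bpt s)
      have h2 : ‖(r : ℂ) * bpt s - bpt s‖ = 1 - r := by
        have : (r : ℂ) * bpt s - bpt s = ((r - 1 : ℝ) : ℂ) * bpt s := by push_cast; ring
        rw [this, norm_mul, norm_bpt, Complex.norm_real, Real.norm_eq_abs, abs_of_neg (by linarith)]
        ring
      linarith
    have hAM : ‖bpt t - bpt s‖ ≤ e / 2 + 2 * D ^ 2 / e := by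
      refine hab.trans ?_
      rw [div_add_div _ _ two_ne_zero he0.ne', le_div_iff₀ (by positivity)]
      nlinarith [sq_nonneg (e - 2 * D)]
    have hkD : (1 - r ^ 2) / D ^ 2 * (e / 2 + 2 * D ^ 2 / e)
        = e / 2 * ((1 - r ^ 2) / D ^ 2) + 2 * e := by
      rw [← hee]
      field_simp
    rw [norm_mul, Real.norm_of_nonneg (by positivity), Real.norm_eq_abs]
    calc _ ≤ (1 - r ^ 2) / D ^ 2 * (K * (e / 2 + 2 * D ^ 2 / e)) := by
          gcongr
          exact (hΨ _ _).trans (by gcongr)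
      _ = K * ((1 - r ^ 2) / D ^ 2 * (e / 2 + 2 * D ^ 2 / e)) := by ring
      _ = _ := by rw [hkD]; ring
  have hbound : Integrable
      (fun t => K / 2 * e * ((1 - r ^ 2) / ‖bpt t - (r : ℂ) * bpt s‖ ^ 2) + 2 * K * e) θm :=
    (hk.const_mul _).add (integrable_const _)
  have hint : Integrable (fun t => (1 - r ^ 2) / ‖bpt t - (r : ℂ) * bpt s‖ ^ 2 *
      (Ψ (bpt t) - Ψ (bpt s))) θm :=
    Integrable.mono' hbound (Measurable.aestronglyMeasurable (by fun_prop))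
      (Eventually.of_forall hdiff)
  have hsplit : (∫ t, (1 - r ^ 2) / ‖bpt t - (r : ℂ) * bpt s‖ ^ 2 * Ψ (bpt t) ∂θm)
      - 2 * Real.pi * Ψ (bpt s)
      = ∫ t, (1 - r ^ 2) / ‖bpt t - (r : ℂ) * bpt s‖ ^ 2 * (Ψ (bpt t) - Ψ (bpt s)) ∂θm := by
    have : ∀ t, (1 - r ^ 2) / ‖bpt t - (r : ℂ) * bpt s‖ ^ 2 * Ψ (bpt t)
        = (1 - r ^ 2) / ‖bpt t - (r : ℂ) * bpt s‖ ^ 2 * (Ψ (bpt t) - Ψ (bpt s))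
          + (1 - r ^ 2) / ‖bpt t - (r : ℂ) * bpt s‖ ^ 2 * Ψ (bpt s) := fun t => by ring
    simp_rw [this]
    rw [integral_add hint (hk.mul_const _), integral_mul_const, hI]
    ring
  rw [hsplit, ← Real.norm_eq_abs]
  refine (norm_integral_le_of_norm_le hbound (Eventually.of_forall hdiff)).trans (le_of_eq ?_)
  rw [integral_add (hk.const_mul _) (integrable_const _), integral_const_mul, hI, integral_const]
  have : θm.real univ = 2 * Real.pi := by
    simp [θm, Real.two_pi_pos.le]
  rw [this, smul_eq_mul]
  ring

theorem integral_mul_nonneg_of_poisson_nonneg {v : ℝ → ℝ} (hv : Integrable v θm)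
    (h : ∀ z ∈ disc, 0 ≤ ∫ t, (1 - ‖z‖ ^ 2) / ‖bpt t - z‖ ^ 2 * v t ∂θm)
    {Ψ : ℂ → ℝ} {K : ℝ} (hK : 0 ≤ K) (hΨ : ∀ x y, |Ψ x - Ψ y| ≤ K * ‖x - y‖)
    (hΨm : Measurable Ψ) (hΨ0 : ∀ x, 0 ≤ Ψ x) (hΨ1 : ∀ x, Ψ x ≤ 1) :
    0 ≤ ∫ t, v t * Ψ (bpt t) ∂θm := by
  have hb := measurable_bpt
  have hvΨ : Integrable (fun t => v t * Ψ (bpt t)) θm := by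
    have := hv.bdd_mul (f := fun t => Ψ (bpt t)) (c := 1)
      (Measurable.aestronglyMeasurable (by fun_prop))
      (Eventually.of_forall fun t => by rw [Real.norm_of_nonneg (hΨ0 _)]; exact hΨ1 _)
    simpa [mul_comm] using this
  have key : ∀ r : ℝ, 0 < r → r < 1 →
      -(5 * Real.pi * K * √(1 - r ^ 2) * ∫ t, ‖v t‖ ∂θm)
        ≤ 2 * Real.pi * ∫ t, v t * Ψ (bpt t) ∂θm := by
    intro r hr hr1
    have hpos : 0 < 1 - r ^ 2 := by nlinarith
    have hprod : Integrable (Function.uncurry fun t s =>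
        ((1 - r ^ 2) / ‖bpt s - (r : ℂ) * bpt t‖ ^ 2 * Ψ (bpt t)) * v s) (θm.prod θm) := by
      refine (hv.comp_snd θm).bdd_mul (c := (1 - r ^ 2) / (1 - r) ^ 2 * 1)
        (f := fun p : ℝ × ℝ => (1 - r ^ 2) / ‖bpt p.2 - (r : ℂ) * bpt p.1‖ ^ 2 * Ψ (bpt p.1)) ?_ ?_
      · exact Measurable.aestronglyMeasurable (by fun_prop)
      · refine Eventually.of_forall fun p => ?_
        have := one_sub_le_norm_bpt_sub p.2 ((r : ℂ) * bpt p.1)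
        rw [norm_smul_bpt hr.le] at this
        have h1r : 0 < 1 - r := by linarith
        rw [Real.norm_of_nonneg (mul_nonneg (by positivity) (hΨ0 _))]
        gcongr
        exacts [hΨ0 _, hΨ1 _]
    have hswap := integral_integral_swap hprod
    have h0 : 0 ≤
        ∫ t, ∫ s, ((1 - r ^ 2) / ‖bpt s - (r : ℂ) * bpt t‖ ^ 2 * Ψ (bpt t)) * v s ∂θm ∂θm := by
      refine integral_nonneg fun t => ?_
      have := h _ (smul_bpt_mem_disc hr.le hr1 t)
      rw [norm_smul_bpt hr.le] at this
      have h2 := mul_nonneg (hΨ0 (bpt t)) this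
      rw [← integral_const_mul] at h2
      refine h2.trans_eq (integral_congr_ae (Eventually.of_forall fun s => ?_))
      ring
    rw [hswap] at h0
    have hle : ∀ s, |(∫ t, ((1 - r ^ 2) / ‖bpt s - (r : ℂ) * bpt t‖ ^ 2 * Ψ (bpt t)) * v s ∂θm)
        - 2 * Real.pi * (v s * Ψ (bpt s))| ≤ 5 * Real.pi * K * √(1 - r ^ 2) * ‖v s‖ := by
      intro s
      have := abs_poisson_sub_le hK hΨ hΨm s hr hr1
      simp_rw [norm_sub_smul_comm (norm_bpt _) (norm_bpt s)] at this
      have heq : (∫ t, ((1 - r ^ 2) / ‖bpt s - (r : ℂ) * bpt t‖ ^ 2 * Ψ (bpt t)) * v s ∂θm)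
          - 2 * Real.pi * (v s * Ψ (bpt s))
          = ((∫ t, (1 - r ^ 2) / ‖bpt s - (r : ℂ) * bpt t‖ ^ 2 * Ψ (bpt t) ∂θm)
            - 2 * Real.pi * Ψ (bpt s)) * v s := by
        rw [integral_mul_const]; ring
      rw [heq, abs_mul, Real.norm_eq_abs]
      exact mul_le_mul_of_nonneg_right this (abs_nonneg _)
    have hi := hprod.integral_prod_right
    simp only [Function.uncurry] at hi
    have hs : (∫ s, ∫ t, ((1 - r ^ 2) / ‖bpt s - (r : ℂ) * bpt t‖ ^ 2 * Ψ (bpt t)) * v s ∂θm ∂θm)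
        - 2 * Real.pi * ∫ t, v t * Ψ (bpt t) ∂θm
          ≤ 5 * Real.pi * K * √(1 - r ^ 2) * ∫ t, ‖v t‖ ∂θm := by
      rw [← integral_const_mul, ← integral_const_mul, ← integral_sub hi (hvΨ.const_mul _)]
      refine integral_mono (hi.sub (hvΨ.const_mul _)) (hv.norm.const_mul _) fun s => ?_
      exact (le_abs_self _).trans (hle s)
    linarith
  have hlim : Tendsto (fun r : ℝ => -(5 * Real.pi * K * √(1 - r ^ 2) * ∫ t, ‖v t‖ ∂θm))
      (𝓝[<] 1) (𝓝 0) := by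
    have : Continuous (fun r : ℝ => -(5 * Real.pi * K * √(1 - r ^ 2) * ∫ t, ‖v t‖ ∂θm)) := by
      fun_prop
    have h1 := (this.tendsto 1).mono_left (nhdsWithin_le_nhds (s := Iio 1))
    simpa using h1
  have := le_of_tendsto hlim (b := 2 * Real.pi * ∫ t, v t * Ψ (bpt t) ∂θm) (by
    filter_upwards [Ioo_mem_nhdsLT (zero_lt_one' ℝ)] with r hr
    exact key r hr.1 hr.2)
  exact nonneg_of_mul_nonneg_right this Real.two_pi_pos

theorem injOn_bpt : InjOn bpt (Ioc 0 (2 * Real.pi)) := by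
  have := injOn_circleMap_of_abs_sub_le (a := 0) (b := 2 * Real.pi) (R := 1) (c := 0) one_ne_zero
    (by rw [zero_sub, abs_neg, abs_of_pos Real.two_pi_pos])
  rw [uIoc_of_le Real.two_pi_pos.le] at this
  intro s hs t ht hst
  refine this hs ht ?_
  rw [← bpt_eq_circleMap, ← bpt_eq_circleMap, hst]

theorem ae_nonneg_of_poisson_nonneg {v : ℝ → ℝ} (hv : Integrable v θm)
    (h : ∀ z ∈ disc, 0 ≤ ∫ t, (1 - ‖z‖ ^ 2) / ‖bpt t - z‖ ^ 2 * v t ∂θm) :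
    ∀ᵐ t ∂θm, 0 ≤ v t := by
  have hcpt : ∀ F ⊆ Ioc 0 (2 * Real.pi), IsCompact F → 0 ≤ ∫ t in F, v t ∂θm := by
    intro F hF hFc
    set E := bpt '' F
    have hE : IsClosed E := (hFc.image continuous_bpt).isClosed
    have hpos : ∀ n : ℕ, (0:ℝ) < 1 / ((n : ℝ) + 1) := fun n => by positivity
    have hlim := thickenedIndicator_tendsto_indicator_closure hpos
      tendsto_one_div_add_atTop_nhds_zero_nat E
    rw [hE.closure_eq, tendsto_pi_nhds] at hlim
    have hb := measurable_bpt
    have hn : ∀ n, Measurable fun x => (thickenedIndicator (hpos n) E x : ℝ) := fun n =>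
      (NNReal.continuous_coe.comp (thickenedIndicator (hpos n) E).continuous).measurable
    have hD : Tendsto (fun n => ∫ t, v t * (thickenedIndicator (hpos n) E (bpt t) : ℝ) ∂θm) atTop
        (𝓝 (∫ t, F.indicator v t ∂θm)) := by
      refine tendsto_integral_of_dominated_convergence (fun t => ‖v t‖) (fun n => ?_) hv.norm
        (fun n => Eventually.of_forall fun t => ?_) ?_
      · exact hv.aestronglyMeasurable.mul
          (((hn n).comp hb).aestronglyMeasurable)
      · rw [norm_mul]
        refine mul_le_of_le_one_right (norm_nonneg _) ?_
        rw [Real.norm_of_nonneg (NNReal.coe_nonneg _)]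
        exact_mod_cast thickenedIndicator_le_one (hpos n) E (bpt t)
      · filter_upwards [ae_restrict_mem (μ := volume) measurableSet_Ioc] with t ht
        have h1 := (NNReal.tendsto_coe.2 (hlim (bpt t))).const_mul (v t)
        convert h1 using 2
        by_cases htF : t ∈ F
        · simp [htF, E, mem_image_of_mem bpt htF]
        · have : bpt t ∉ E := by
            rintro ⟨s, hs, hst⟩
            exact htF (injOn_bpt (hF hs) ht hst ▸ hs)
          simp [htF, this]
    rw [← integral_indicator hFc.measurableSet]
    refine ge_of_tendsto' hD fun n => ?_
    refine integral_mul_nonneg_of_poisson_nonneg hv h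
      (Ψ := fun x => (thickenedIndicator (hpos n) E x : ℝ))
      (K := ((1 / ((n : ℝ) + 1)).toNNReal⁻¹ : NNReal)) (NNReal.coe_nonneg _) (fun x y => ?_) (hn n)
      (fun _ => NNReal.coe_nonneg _)
      (fun x => by exact_mod_cast thickenedIndicator_le_one (hpos n) E x)
    have := (lipschitzWith_thickenedIndicator (hpos n) E).dist_le_mul x y
    rwa [NNReal.dist_eq, dist_eq_norm] at this
  by_contra hcon
  have hm : NullMeasurableSet {t | ¬ 0 ≤ v t} θm := by
    have := nullMeasurableSet_lt hv.aemeasurable (aemeasurable_const (b := (0:ℝ)))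
    simpa using this
  obtain ⟨A, hAs, hAm, hAe⟩ := hm.exists_measurable_subset_ae_eq
  have hA : 0 < θm A := by
    rw [measure_congr hAe]
    exact pos_iff_ne_zero.2 hcon
  rw [θm, Measure.restrict_apply hAm] at hA
  obtain ⟨F, hFA, hFc, hF0⟩ := (hAm.inter measurableSet_Ioc).exists_lt_isCompact hA
  have hFI : F ⊆ Ioc 0 (2 * Real.pi) := fun t ht => (hFA ht).2
  have hneg : ∀ t ∈ F, v t < 0 := fun t ht => not_le.1 (hAs (hFA ht).1)
  have h1 := hcpt F hFI hFc
  have hnn : 0 ≤ᵐ[θm.restrict F] fun t => -v t := by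
    filter_upwards [ae_restrict_mem hFc.measurableSet] with t ht
    have := hneg t ht
    simp only [Pi.zero_apply]; linarith
  have h2 : ∫ t in F, -v t ∂θm = 0 :=
    le_antisymm (by rw [integral_neg]; linarith) (integral_nonneg_of_ae hnn)
  rw [setIntegral_eq_zero_iff_of_nonneg_ae hnn hv.neg.integrableOn] at h2
  have h3 : ∀ᵐ t ∂(θm.restrict F), False := by
    filter_upwards [h2, ae_restrict_mem hFc.measurableSet] with t ht htF
    have := hneg t htF
    simp only [Pi.zero_apply] at ht; linarith
  have h4 : θm.restrict F = 0 := by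
    rw [← ae_eq_bot]; exact Filter.eventually_false_iff_eq_bot.1 h3
  rw [Measure.restrict_eq_zero, θm, Measure.restrict_apply hFc.measurableSet,
    inter_eq_left.2 hFI] at h4
  exact hF0.ne' h4

theorem ae_le_of_re_herg_le {u : ℝ → ℝ} (hu : Integrable u θm) {c : ℝ}
    (h : ∀ z ∈ disc, (herg u z).re ≤ c) : ∀ᵐ t ∂θm, u t ≤ c := by
  have hv : Integrable (fun t => c - u t) θm := (integrable_const c).sub hu
  have := ae_nonneg_of_poisson_nonneg hv fun z hz => by
    have h1 := h z hz
    rw [re_herg hu hz, inv_mul_le_iff₀ Real.two_pi_pos] at h1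
    simp_rw [mul_sub]
    rw [integral_sub ((integrable_poisson hz).mul_const c) (integrable_poisson_mul hu hz),
      integral_mul_const, integral_poisson hz]
    linarith
  filter_upwards [this] with t ht
  linarith

theorem integral_normSq_mul_le {f k : ℂ → ℂ} (hf : DifferentiableOn ℂ f disc)
    (hk : DifferentiableOn ℂ k disc) {M : ℝ} (hM : ∀ z ∈ disc, ‖f z‖ ≤ M) {r : ℝ} (hr : 0 ≤ r)
    (hr1 : r < 1) :
    ∫ t in (0:ℝ)..(2 * Real.pi), ‖f ((r : ℂ) * bpt t) * k ((r : ℂ) * bpt t)‖ ^ 2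
      ≤ M ^ 2 * ∫ t in (0:ℝ)..(2 * Real.pi), ‖k ((r : ℂ) * bpt t)‖ ^ 2 := by
  have c0 := continuous_smul_bpt hf hr hr1
  have c1 := continuous_smul_bpt hk hr hr1
  rw [← intervalIntegral.integral_const_mul]
  refine intervalIntegral.integral_mono_on Real.two_pi_pos.le
    (((c0.mul c1).norm.pow 2).intervalIntegrable _ _)
    ((continuous_const.mul (c1.norm.pow 2)).intervalIntegrable _ _) fun t _ => ?_
  rw [norm_mul, mul_pow]
  have := hM _ (smul_bpt_mem_disc hr hr1 t)
  gcongr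

theorem integral_normSq_le_of_bound {k : ℂ → ℂ} (hk : DifferentiableOn ℂ k disc) {B : ℝ}
    (hB : ∀ z ∈ disc, ‖k z‖ ≤ B) {r : ℝ} (hr : 0 ≤ r) (hr1 : r < 1) :
    ∫ t in (0:ℝ)..(2 * Real.pi), ‖k ((r : ℂ) * bpt t)‖ ^ 2 ≤ 2 * Real.pi * B ^ 2 := by
  have c1 := continuous_smul_bpt hk hr hr1
  have : ∫ t in (0:ℝ)..(2 * Real.pi), ‖k ((r : ℂ) * bpt t)‖ ^ 2
      ≤ ∫ _ in (0:ℝ)..(2 * Real.pi), B ^ 2 := by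
    refine intervalIntegral.integral_mono_on Real.two_pi_pos.le
      ((c1.norm.pow 2).intervalIntegrable _ _) intervalIntegrable_const fun t _ => ?_
    have := hB _ (smul_bpt_mem_disc hr hr1 t)
    gcongr
  simpa using this

theorem norm_sub_sum_range_le {c : ℕ → ℂ} (hc : Summable fun n => ‖c n‖) {z S : ℂ} (hz : ‖z‖ ≤ 1)
    (hS : HasSum (fun n => c n * z ^ n) S) (N : ℕ) :
    ‖S - ∑ n ∈ Finset.range N, c n * z ^ n‖ ≤ ∑' n, ‖c (n + N)‖ := by
  have h1 := (hasSum_nat_add_iff' N).2 hS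
  have h2 : ∀ n, ‖c (n + N) * z ^ (n + N)‖ ≤ ‖c (n + N)‖ := fun n => by
    rw [norm_mul, norm_pow]
    exact mul_le_of_le_one_right (norm_nonneg _) (pow_le_one₀ (norm_nonneg _) hz)
  have h3 := tsum_of_norm_bounded ((summable_nat_add_iff N).2 hc).hasSum h2
  rwa [h1.tsum_eq] at h3

theorem deriv_dilation (h : ℂ → ℂ) (r : ℝ) (z : ℂ) :
    deriv (fun z => h ((r : ℂ) * z)) z = (r : ℂ) * deriv h ((r : ℂ) * z) := by
  rw [deriv_comp_mul_left, smul_eq_mul]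

theorem mul_mem_disc {r : ℝ} (hr : 0 < r) (hr1 : r < 1) {z : ℂ} (hz : ‖z‖ ≤ 1) :
    (r : ℂ) * z ∈ disc := by
  rw [disc, mem_ball_zero_iff, norm_mul, Complex.norm_real, Real.norm_of_nonneg hr.le]
  nlinarith [norm_nonneg z]

theorem exists_polynomial_approx_dilation {h : ℂ → ℂ} (hh : DifferentiableOn ℂ h disc) {r : ℝ}
    (hr : 0 < r) (hr1 : r < 1) {ε : ℝ} (hε : 0 < ε) :
    ∃ q : Polynomial ℂ, ∀ z ∈ disc, ‖h ((r : ℂ) * z) - q.eval z‖ ≤ ε ∧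
      ‖deriv (fun z => h ((r : ℂ) * z) - q.eval z) z‖ ≤ ε := by
  set c : ℕ → ℂ := fun n => taylorCoeff h n * (r : ℂ) ^ n
  set c' : ℕ → ℂ := fun n => r * (taylorCoeff (deriv h) n * (r : ℂ) ^ n)
  have hh' : DifferentiableOn ℂ (deriv h) disc := hh.deriv isOpen_ball
  have hc : Summable fun n => ‖c n‖ := by
    simpa [c, abs_of_pos hr] using summable_norm_taylorCoeff hh hr.le hr1
  have hc' : Summable fun n => ‖c' n‖ := by
    simpa [c', abs_of_pos hr] using (summable_norm_taylorCoeff hh' hr.le hr1).mul_left r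
  have h1 := tendsto_sum_nat_add fun n => ‖c n‖
  have h2 := tendsto_sum_nat_add fun n => ‖c' n‖
  obtain ⟨N, hN1, hN2⟩ := (((tendsto_add_atTop_iff_nat 1).2 h1).eventually_le_const hε |>.and
    (h2.eventually_le_const hε)).exists
  refine ⟨∑ n ∈ Finset.range (N + 1), Polynomial.C (c n) * Polynomial.X ^ n, fun z hz => ?_⟩
  have hz1 : ‖z‖ < 1 := by simpa [disc] using hz
  have hrz := mul_mem_disc hr hr1 hz1.le
  constructor
  · rw [Polynomial.eval_finsetSum]
    simp only [Polynomial.eval_mul, Polynomial.eval_C, Polynomial.eval_pow, Polynomial.eval_X]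
    refine (norm_sub_sum_range_le hc hz1.le ?_ (N + 1)).trans hN1
    simpa [c, mul_pow, mul_assoc] using hasSum_taylorCoeff hh hrz
  · have hd : DifferentiableAt ℂ (fun z => h ((r : ℂ) * z)) z :=
      (hh.differentiableAt (isOpen_ball.mem_nhds hrz)).comp z (by fun_prop)
    rw [deriv_fun_sub hd (Polynomial.differentiableAt _), deriv_dilation, Polynomial.deriv,
      Polynomial.derivative_sum, Polynomial.eval_finsetSum, Finset.sum_range_succ']
    have : ∀ n, (Polynomial.derivative (Polynomial.C (c (n + 1)) * Polynomial.X ^ (n + 1))).eval z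
        = c' n * z ^ n := by
      intro n
      rw [Polynomial.derivative_C_mul_X_pow]
      simp only [Polynomial.eval_mul, Polynomial.eval_C, Polynomial.eval_pow, Polynomial.eval_X,
        Nat.add_sub_cancel, c, c', taylorCoeff_deriv]
      push_cast
      ring
    simp only [this, pow_zero, mul_one, Polynomial.derivative_C, Polynomial.eval_zero, add_zero]
    refine (norm_sub_sum_range_le hc' hz1.le ?_ N).trans hN2
    have h3 := (hasSum_taylorCoeff hh' hrz).mul_left (r : ℂ)
    simpa [c', mul_pow, mul_assoc] using h3

theorem tendsto_integral_normSq_sub_dilation {h : ℂ → ℂ} (hh : DifferentiableOn ℂ h disc) {B : ℝ}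
    (hB : ∀ z ∈ disc, ‖h z‖ ≤ B) {ε : ℝ} (hε : 0 < ε) :
    ∀ᶠ r : ℝ in 𝓝[<] 1, ∀ s : ℝ, 0 < s → s < 1 →
      ∫ t in (0:ℝ)..(2 * Real.pi), ‖h ((s : ℂ) * bpt t) - h ((r : ℂ) * ((s : ℂ) * bpt t))‖ ^ 2
        ≤ ε := by
  have hsum := (summable_normSq_taylorCoeff hh fun r hr hr1 =>
    integral_normSq_le_of_bound hh hB hr.le hr1).1
  have hlim : Tendsto (fun r : ℝ => ∑' n, 2 * Real.pi * ‖taylorCoeff h n * (1 - (r : ℂ) ^ n)‖ ^ 2)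
      (𝓝[<] 1) (𝓝 (∑' _ : ℕ, (0:ℝ))) := by
    refine tendsto_tsum_of_dominated_convergence hsum (fun n => ?_) ?_
    · have : Continuous fun r : ℝ => 2 * Real.pi * ‖taylorCoeff h n * (1 - (r : ℂ) ^ n)‖ ^ 2 := by
        fun_prop
      have h1 := (this.tendsto 1).mono_left (nhdsWithin_le_nhds (s := Iio 1))
      simpa using h1
    · filter_upwards [Ioo_mem_nhdsLT (zero_lt_one' ℝ)] with r hr n
      rw [Real.norm_of_nonneg (by positivity), norm_mul]
      have h1 : ‖1 - (r : ℂ) ^ n‖ ≤ 1 := by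
        rw [← Complex.ofReal_pow, ← Complex.ofReal_one, ← Complex.ofReal_sub, Complex.norm_real,
          Real.norm_of_nonneg (sub_nonneg.2 (pow_le_one₀ hr.1.le hr.2.le))]
        linarith [pow_nonneg hr.1.le n]
      gcongr
      exact mul_le_of_le_one_right (norm_nonneg _) h1
  rw [tsum_zero] at hlim
  filter_upwards [hlim.eventually_le_const hε, Ioo_mem_nhdsLT (zero_lt_one' ℝ)]
    with r hr hr1 s hs hs1
  have hrn : ∀ n, ‖1 - (r : ℂ) ^ n‖ ≤ 1 := fun n => by
    rw [← Complex.ofReal_pow, ← Complex.ofReal_one, ← Complex.ofReal_sub, Complex.norm_real,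
      Real.norm_of_nonneg (sub_nonneg.2 (pow_le_one₀ hr1.1.le hr1.2.le))]
    linarith [pow_nonneg hr1.1.le n]
  have hsc : Summable fun n => ‖taylorCoeff h n * (1 - (r : ℂ) ^ n) * (s : ℂ) ^ n‖ := by
    refine Summable.of_nonneg_of_le (fun n => norm_nonneg _) (fun n => ?_)
      (summable_norm_taylorCoeff hh hs.le hs1)
    rw [norm_mul, norm_mul, norm_pow, Complex.norm_real, Real.norm_of_nonneg hs.le]
    gcongr
    exact mul_le_of_le_one_right (norm_nonneg _) (hrn n)
  have hS := hasSum_normSq_of_hasSum hsc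
    (G := fun t => h ((s : ℂ) * bpt t) - h ((r : ℂ) * ((s : ℂ) * bpt t))) fun t => by
      have h1 := hasSum_taylorCoeff hh (smul_bpt_mem_disc hs.le hs1 t)
      have h2 := hasSum_taylorCoeff hh (mul_mem_disc hr1.1 hr1.2
        ((norm_smul_bpt hs.le t).trans_le hs1.le))
      refine (h1.sub h2).congr_fun fun n => ?_
      simp only [mul_pow]; ring
  refine le_trans (hasSum_le (fun n => ?_) hS (Summable.hasSum ?_)) hr
  · rw [norm_mul _ ((s : ℂ) ^ n), norm_pow, Complex.norm_real, Real.norm_of_nonneg hs.le]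
    gcongr
    exact mul_le_of_le_one_right (norm_nonneg _) (pow_le_one₀ hs.le hs1.le)
  · refine Summable.of_nonneg_of_le (fun n => by positivity) (fun n => ?_) hsum
    rw [norm_mul]
    gcongr
    exact mul_le_of_le_one_right (norm_nonneg _) (hrn n)

theorem eventually_dilation_close {F : ℂ → ℂ} {U K : Set ℂ} (hU : IsOpen U) (hF : ContinuousOn F U)
    (hK : IsCompact K) (hKU : K ⊆ U) {ε : ℝ} (hε : 0 < ε) (m : ℝ → ℂ) (hm : Continuous m)
    (hm1 : m 1 = 1) :
    ∀ᶠ r : ℝ in 𝓝 1, ∀ z ∈ K, ‖F z - m r * F ((r : ℂ) * z)‖ ≤ ε := by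
  refine hK.eventually_forall_of_forall_eventually fun z hz => ?_
  have hFz : ContinuousAt F z := hF.continuousAt (hU.mem_nhds (hKU hz))
  have hc : Tendsto (fun p : ℝ × ℂ => ‖F p.2 - m p.1 * F ((p.1 : ℂ) * p.2)‖) (𝓝 (1, z)) (𝓝 0) := by
    have h1 : Tendsto (fun p : ℝ × ℂ => (p.1 : ℂ) * p.2) (𝓝 (1, z)) (𝓝 z) := by
      have : Continuous fun p : ℝ × ℂ => (p.1 : ℂ) * p.2 := by fun_prop
      simpa using this.tendsto (1, z)
    have h2 : Tendsto (fun p : ℝ × ℂ => p.2) (𝓝 (1, z)) (𝓝 z) := continuous_snd.tendsto (1, z)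
    have h3 : Tendsto (fun p : ℝ × ℂ => m p.1) (𝓝 (1, z)) (𝓝 1) := by
      simpa [hm1, Function.comp_def] using (hm.comp continuous_fst).tendsto ((1 : ℝ), z)
    have h4 := ((hFz.tendsto.comp h2).sub (h3.mul (hFz.tendsto.comp h1))).norm
    simpa using h4
  exact hc.eventually_le_const hε

theorem SmallAt.of_bound {f k : ℂ → ℂ} (hf : DifferentiableOn ℂ f disc)
    (hk : DifferentiableOn ℂ k disc) {M : ℝ} (hM0 : 0 ≤ M) (hM : ∀ z ∈ disc, ‖f z‖ ≤ M) (ζ : ℂ)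
    (δ : ℝ) {η : ℝ} (hη : 0 ≤ η)
    (hb : ∀ z ∈ disc, ‖k z‖ ≤ η ∧ ‖deriv k z‖ ≤ η) : SmallAt f ζ δ ((1 + 3 * M) * η) k where
  diff := hk
  bound z hz _ := (hb z hz).1.trans (by nlinarith [mul_nonneg hM0 hη])
  bound_deriv z hz _ := (hb z hz).2.trans (by nlinarith [mul_nonneg hM0 hη])
  mean r hr hr1 := by
    have h1 := integral_normSq_mul_le hf hk hM hr.le hr1
    have h2 := integral_normSq_le_of_bound hk (fun z hz => (hb z hz).1) hr.le hr1
    have h3 := Real.pi_lt_four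
    have h4 := Real.pi_pos
    have h5 : M ^ 2 * (2 * Real.pi * η ^ 2) ≤ 9 * (M * η) ^ 2 := by
      have : 0 ≤ (M * η) ^ 2 := sq_nonneg _
      nlinarith [Real.pi_lt_d2]
    have h6 : M ^ 2 * (∫ t in (0:ℝ)..(2 * Real.pi), ‖k ((r : ℂ) * bpt t)‖ ^ 2)
        ≤ M ^ 2 * (2 * Real.pi * η ^ 2) := by gcongr
    have h7 : 9 * (M * η) ^ 2 ≤ ((1 + 3 * M) * η) ^ 2 := by
      nlinarith [mul_nonneg hM0 hη, mul_nonneg (mul_nonneg hM0 hη) hη, sq_nonneg η]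
    linarith

theorem exists_polynomial_smallAt {f h : ℂ → ℂ} {M B : ℝ} (hf : DifferentiableOn ℂ f disc)
    (hM0 : 0 ≤ M) (hM : ∀ z ∈ disc, ‖f z‖ ≤ M) {U : Set ℂ} (hU : IsOpen U) (hdU : disc ⊆ U) {ζ : ℂ}
    {δ : ℝ} (hKU : ∀ z, ‖z‖ ≤ 1 → δ ≤ ‖z - ζ‖ → z ∈ U) (hh : DifferentiableOn ℂ h U)
    (hB : ∀ z ∈ disc, ‖h z‖ ≤ B) {ε : ℝ} (hε : 0 < ε) :
    ∃ q : Polynomial ℂ, SmallAt f ζ δ ε (fun z => h z - q.eval z) := by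
  have hhd := hh.mono hdU
  set K : Set ℂ := closedBall 0 1 ∩ {z | δ ≤ ‖z - ζ‖} with hKdef
  have hK : IsCompact K := (isCompact_closedBall 0 1).inter_right
    (isClosed_le continuous_const (by fun_prop))
  have hKsub : K ⊆ U := fun z hz => hKU z (by simpa using hz.1) hz.2
  have hε4 : 0 < ε / 4 := by positivity
  have hη : 0 < (ε / 4) ^ 2 / (M ^ 2 + 1) := by positivity
  have e1 := eventually_dilation_close hU hh.continuousOn hK hKsub hε4 (fun _ => 1)
    continuous_const rfl
  have e2 := eventually_dilation_close hU (hh.deriv hU).continuousOn hK hKsub hε4 (fun r => (r : ℂ))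
    Complex.continuous_ofReal Complex.ofReal_one
  obtain ⟨r, ⟨hr, hr1⟩, hr2, hr3, hr4⟩ := (Filter.Eventually.and (Ioo_mem_nhdsLT (zero_lt_one' ℝ))
    ((e1.filter_mono nhdsWithin_le_nhds).and ((e2.filter_mono nhdsWithin_le_nhds).and
    (tendsto_integral_normSq_sub_dilation hhd hB hη)))).exists
  have hdil : DifferentiableOn ℂ (fun z => h ((r : ℂ) * z)) disc := fun z hz => by
    have hz1 : ‖z‖ < 1 := by simpa [disc] using hz
    have hrz := mul_mem_disc hr hr1 hz1.le
    exact ((hhd.differentiableAt (isOpen_ball.mem_nhds hrz)).comp z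
      (by fun_prop)).differentiableWithinAt
  have s1 : SmallAt f ζ δ (ε / 4) fun z => h z - h ((r : ℂ) * z) :=
    { diff := hhd.sub hdil
      bound := fun z hz hd => by
        have hz1 : ‖z‖ < 1 := by simpa [disc] using hz
        simpa using hr2 z ⟨by simpa using hz1.le, hd⟩
      bound_deriv := fun z hz hd => by
        have hz1 : ‖z‖ < 1 := by simpa [disc] using hz
        have hn := isOpen_ball.mem_nhds hz
        rw [deriv_fun_sub (hhd.differentiableAt hn) (hdil.differentiableAt hn), deriv_dilation]
        exact hr3 z ⟨by simpa using hz1.le, hd⟩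
      mean := fun s hs hs1 => by
        refine (integral_normSq_mul_le hf (hhd.sub hdil) hM hs.le hs1).trans ?_
        have := hr4 s hs hs1
        rw [le_div_iff₀ (by positivity)] at this
        have h0 : 0 ≤ ∫ t in (0:ℝ)..(2 * Real.pi),
            ‖h ((s : ℂ) * bpt t) - h ((r : ℂ) * ((s : ℂ) * bpt t))‖ ^ 2 :=
          intervalIntegral.integral_nonneg Real.two_pi_pos.le fun _ _ => sq_nonneg _
        simp only [Pi.sub_apply]
        linarith }
  obtain ⟨q, hq⟩ := exists_polynomial_approx_dilation hhd hr hr1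
    (ε := ε / 4 / (1 + 3 * M)) (by positivity)
  refine ⟨q, ?_⟩
  have s2 := SmallAt.of_bound hf (hdil.sub q.differentiable.differentiableOn) hM0 hM ζ δ
    (by positivity) hq
  have s3 := s1.add hf s2 hε4.le (by positivity)
  convert s3 using 1
  · field_simp; ring
  · funext z; simp

theorem integral_smul_bpt {E : ℂ → ℂ} (hE : DifferentiableOn ℂ E disc) {r : ℝ} (hr : 0 ≤ r)
    (hr1 : r < 1) :
    ∫ t in (0:ℝ)..(2 * Real.pi), E ((r : ℂ) * bpt t) = ((2 * Real.pi : ℝ) : ℂ) * E 0 := by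
  have h : DiffContOnCl ℂ E (ball 0 |r|) :=
    hE.diffContOnCl_ball (closedBall_subset_ball (by rwa [abs_of_nonneg hr]))
  have h1 := h.circleAverage
  have hpi : ((2 * Real.pi : ℝ) : ℂ) ≠ 0 := by exact_mod_cast Real.two_pi_pos.ne'
  rw [Real.circleAverage_def] at h1
  simp only [← bpt_eq_circleMap, Complex.real_smul] at h1
  rw [← h1, Complex.ofReal_inv, mul_inv_cancel_left₀ hpi]

theorem integral_normSq_one_sub_le {E : ℂ → ℂ} (hE : DifferentiableOn ℂ E disc)
    (hE1 : ∀ z ∈ disc, ‖E z‖ ≤ 1) {r : ℝ} (hr : 0 ≤ r) (hr1 : r < 1) :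
    ∫ t in (0:ℝ)..(2 * Real.pi), ‖1 - E ((r : ℂ) * bpt t)‖ ^ 2
      ≤ 4 * Real.pi * (1 - (E 0).re) := by
  have c1 := continuous_smul_bpt hE hr hr1
  have cre : Continuous fun t => (E ((r : ℂ) * bpt t)).re := Complex.continuous_re.comp c1
  have hre : ∫ t in (0:ℝ)..(2 * Real.pi), (E ((r : ℂ) * bpt t)).re = 2 * Real.pi * (E 0).re := by
    have h1 := congrArg Complex.re (integral_smul_bpt hE hr hr1)
    rw [Complex.re_ofReal_mul, intervalIntegral.integral_of_le Real.two_pi_pos.le] at h1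
    rw [← h1, intervalIntegral.integral_of_le Real.two_pi_pos.le]
    exact integral_re (𝕜 := ℂ) (c1.intervalIntegrable 0 (2 * Real.pi)).1
  calc _ ≤ ∫ t in (0:ℝ)..(2 * Real.pi), (2 - 2 * (E ((r : ℂ) * bpt t)).re) := by
        refine intervalIntegral.integral_mono_on Real.two_pi_pos.le
          (((continuous_const.sub c1).norm.pow 2).intervalIntegrable _ _)
          ((continuous_const.sub (continuous_const.mul cre)).intervalIntegrable _ _) fun t _ => ?_
        have h1 := hE1 _ (smul_bpt_mem_disc hr hr1 t)
        have h2 : ‖E ((r : ℂ) * bpt t)‖ ^ 2 ≤ 1 := pow_le_one₀ (norm_nonneg _) h1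
        rw [← Complex.normSq_eq_norm_sq, Complex.normSq_apply] at h2 ⊢
        simp only [sub_re, one_re, sub_im, one_im]
        nlinarith
    _ = 4 * Real.pi * (1 - (E 0).re) := by
        have h2 : IntervalIntegrable (fun t => 2 * (E ((r : ℂ) * bpt t)).re) volume 0
          (2 * Real.pi) := (continuous_const.mul cre).intervalIntegrable _ _
        rw [intervalIntegral.integral_sub intervalIntegrable_const h2,
          intervalIntegral.integral_const_mul,
          hre, intervalIntegral.integral_const, smul_eq_mul]
        ring

theorem half_le_norm_bpt_sub {w : ℝ → ℝ} {ζ z : ℂ} {δ : ℝ}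
    (hs : ∀ t, w t ≠ 0 → ‖bpt t - ζ‖ < δ / 2) (hz : δ ≤ ‖z - ζ‖) (t : ℝ) (ht : w t ≠ 0) :
    δ / 2 ≤ ‖bpt t - z‖ := by
  have h1 := hs t ht
  have h2 := norm_sub_le_norm_sub_add_norm_sub z (bpt t) ζ
  rw [norm_sub_rev z (bpt t)] at h2
  linarith

theorem SmallAt.congr {f k k' : ℂ → ℂ} {ζ : ℂ} {δ ε : ℝ} (h : SmallAt f ζ δ ε k)
    (hk : EqOn k' k disc) : SmallAt f ζ δ ε k' where
  diff := h.diff.congr hk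
  bound z hz hd := hk hz ▸ h.bound z hz hd
  bound_deriv z hz hd := by
    rw [(hk.eventuallyEq_of_mem (isOpen_ball.mem_nhds hz)).deriv_eq]
    exact h.bound_deriv z hz hd
  mean r hr hr1 := by
    simp_rw [fun t => hk (smul_bpt_mem_disc hr.le hr1 t)]
    exact h.mean r hr hr1

theorem herg_neg (w : ℝ → ℝ) (z : ℂ) : herg (-w) z = -herg w z := by
  simp [herg, integral_neg]

theorem deriv_exp_neg_herg {u : ℝ → ℝ} (hu : Integrable u θm) {z : ℂ} (hz : z ∈ disc) :
    deriv (fun z => exp (-herg u z)) z = exp (-herg u z) * -deriv (herg u) z := by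
  have hd := ((differentiableOn_herg hu).differentiableAt (isOpen_ball.mem_nhds hz)).hasDerivAt
  exact (hd.fun_neg.cexp).deriv

theorem exists_bound_exp_neg_herg {u : ℝ → ℝ} (hu : Integrable u θm) {ζ : ℂ} {δ : ℝ} (hδ : 0 < δ)
    (hs : ∀ t, u t ≠ 0 → ‖bpt t - ζ‖ < δ / 2) :
    ∃ H : ℝ, 0 ≤ H ∧ ∀ z ∈ disc, δ ≤ ‖z - ζ‖ →
      ‖exp (-herg u z)‖ ≤ H ∧ ‖deriv (fun z => exp (-herg u z)) z‖ ≤ H := by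
  set N := ∫ t, ‖u t‖ ∂θm
  have hN : 0 ≤ N := integral_nonneg fun _ => norm_nonneg _
  set H := Real.exp (2 / (δ / 2) * N)
  have hH : 0 < H := Real.exp_pos _
  refine ⟨H + H * (2 / (δ / 2) ^ 2 * N), by positivity, fun z hz hd => ?_⟩
  have hz1 : ‖z‖ < 1 := by simpa [disc] using hz
  have haw := half_le_norm_bpt_sub hs hd
  have h1 : ‖exp (-herg u z)‖ ≤ H := by
    refine (Complex.norm_exp_le_exp_norm _).trans (Real.exp_le_exp.2 ?_)
    rw [norm_neg]
    exact norm_herg_le hu (half_pos hδ) haw hz1.le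
  constructor
  · have : 0 ≤ H * (2 / (δ / 2) ^ 2 * N) := by positivity
    linarith
  · rw [deriv_exp_neg_herg hu hz, norm_mul, norm_neg]
    have h2 := norm_deriv_herg_le hu (half_pos hδ) haw
    have h3 : ‖exp (-herg u z)‖ * ‖deriv (herg u) z‖ ≤ H * (2 / (δ / 2) ^ 2 * N) := by gcongr
    linarith

theorem norm_exp_le_one_of_re {x : ℂ} (hx : x.re ≤ 0) : ‖exp x‖ ≤ 1 := by
  rw [Complex.norm_exp]; exact Real.exp_le_one_iff.2 hx

theorem exists_smallAt_mul_one_sub_exp {f : ℂ → ℂ} (hf : DifferentiableOn ℂ f disc) {u : ℝ → ℝ}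
    (hu : Integrable u θm) {ζ : ℂ} {δ : ℝ} (hδ : 0 < δ)
    (hs : ∀ t, u t ≠ 0 → ‖bpt t - ζ‖ < δ / 2) {B : ℝ}
    (hB : ∀ z ∈ disc, ‖f z * exp (-herg u z)‖ ≤ B) {ε : ℝ} (hε : 0 < ε) :
    ∃ η > 0, ∀ w : ℝ → ℝ, Integrable w θm → (∀ t, w t ≤ 0) →
      (∀ t, w t ≠ 0 → ‖bpt t - ζ‖ < δ / 2) → ∫ t, ‖w t‖ ∂θm ≤ η →
      SmallAt f ζ δ ε (fun z => exp (-herg u z) * (1 - exp (herg w z))) := by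
  obtain ⟨H, hH0, hH⟩ := exists_bound_exp_neg_herg hu hδ hs
  set A := 2 / (δ / 2) with hA
  set D := 2 / (δ / 2) ^ 2 with hD
  have hA0 : 0 < A := by positivity
  have hD0 : 0 < D := by positivity
  refine ⟨min (1 / A) (min (ε / (H * (2 * A) + H * D + 1)) (ε ^ 2 / (2 * B ^ 2 + 1))),
    by positivity, fun w hw hw0 hws hwη => ?_⟩
  set N := ∫ t, ‖w t‖ ∂θm with hNdef
  have hN : 0 ≤ N := integral_nonneg fun _ => norm_nonneg _
  obtain ⟨hN1, hN2, hN3⟩ : N ≤ 1 / A ∧ N ≤ ε / (H * (2 * A) + H * D + 1) ∧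
      N ≤ ε ^ 2 / (2 * B ^ 2 + 1) := by simpa using hwη
  rw [le_div_iff₀ (by positivity)] at hN1 hN2 hN3
  have hEd : DifferentiableOn ℂ (fun z => exp (herg w z)) disc := (differentiableOn_herg hw).cexp
  have hhd : DifferentiableOn ℂ (fun z => exp (-herg u z)) disc :=
    (differentiableOn_herg hu).fun_neg.cexp
  have hE1 : ∀ z ∈ disc, ‖exp (herg w z)‖ ≤ 1 := fun z hz =>
    norm_exp_le_one_of_re (re_herg_le hw (Eventually.of_forall hw0) hz)
  have h1E : ∀ z ∈ disc, δ ≤ ‖z - ζ‖ → ‖1 - exp (herg w z)‖ ≤ 2 * A * N := by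
    intro z hz hd
    have hz1 : ‖z‖ < 1 := by simpa [disc] using hz
    have h1 : ‖herg w z‖ ≤ A * N :=
      norm_herg_le hw (half_pos hδ) (half_le_norm_bpt_sub hws hd) hz1.le
    have h2 := Complex.norm_exp_sub_one_le (h1.trans (by linarith))
    rw [norm_sub_rev]
    linarith
  refine ⟨hhd.mul ((differentiableOn_const 1).sub hEd), fun z hz hd => ?_, fun z hz hd => ?_,
    fun r hr hr1 => ?_⟩
  · rw [norm_mul]
    have h1 := mul_le_mul (hH z hz hd).1 (h1E z hz hd) (norm_nonneg _) hH0
    have h2 : 0 ≤ H * D * N := by positivity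
    linarith
  · have hn := isOpen_ball.mem_nhds hz
    have hdw := ((differentiableOn_herg hw).differentiableAt hn).hasDerivAt
    have h0 : deriv (fun z => exp (-herg u z) * (1 - exp (herg w z))) z
        = deriv (fun z => exp (-herg u z)) z * (1 - exp (herg w z))
          + exp (-herg u z) * -(exp (herg w z) * deriv (herg w) z) :=
      ((hhd.differentiableAt hn).hasDerivAt.fun_mul (hdw.cexp.const_sub 1)).deriv
    rw [h0]
    have h1 := mul_le_mul (hH z hz hd).2 (h1E z hz hd) (norm_nonneg _) hH0
    have h2 : ‖deriv (herg w) z‖ ≤ D * N :=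
      norm_deriv_herg_le hw (half_pos hδ) (half_le_norm_bpt_sub hws hd)
    have h3 : ‖exp (herg w z) * deriv (herg w) z‖ ≤ D * N := by
      rw [norm_mul]
      exact (mul_le_of_le_one_left (norm_nonneg _) (hE1 z hz)).trans h2
    have h4 := mul_le_mul (hH z hz hd).1 h3 (norm_nonneg _) hH0
    refine (norm_add_le _ _).trans ?_
    rw [norm_mul, norm_mul, norm_neg]
    linarith
  · have h1 := integral_normSq_mul_le (hf.mul hhd) ((differentiableOn_const 1).sub hEd) hB hr.le hr1
    have h2 := integral_normSq_one_sub_le hEd hE1 hr.le hr1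
    have h3 : 1 - (2 * Real.pi)⁻¹ * N ≤ (exp (herg w 0)).re := by
      have h4 : ∫ t, w t ∂θm = -N := by
        rw [hNdef, ← integral_neg]
        congr 1
        funext t
        rw [Real.norm_of_nonpos (hw0 t), neg_neg]
      rw [herg_zero, ← Complex.ofReal_exp, Complex.ofReal_re, h4]
      have := Real.add_one_le_exp ((2 * Real.pi)⁻¹ * -N)
      linarith
    have h5 : 4 * Real.pi * (1 - (exp (herg w 0)).re) ≤ 2 * N := by
      calc _ ≤ 4 * Real.pi * ((2 * Real.pi)⁻¹ * N) := by
            have := Real.pi_pos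
            gcongr
            linarith
        _ = 2 * N := by field_simp; norm_num
    simp only [Pi.mul_apply, Pi.sub_apply, mul_assoc] at h1
    refine h1.trans ?_
    calc _ ≤ B ^ 2 * (2 * N) := by
          gcongr
          exact h2.trans h5
      _ ≤ ε ^ 2 := by linarith

theorem differentiableOn_herg_union {u : ℝ → ℝ} (hu : Integrable u θm) {ζ : ℂ} {δ : ℝ}
    (hs : ∀ t, u t ≠ 0 → ‖bpt t - ζ‖ < δ / 2) :
    DifferentiableOn ℂ (herg u) (disc ∪ {z | δ / 2 < ‖z - ζ‖}) := by
  rintro z (hz | hz)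
  · exact ((differentiableOn_herg hu).differentiableAt
      (isOpen_ball.mem_nhds hz)).differentiableWithinAt
  · refine (hasDerivAt_herg hu (sub_pos.2 hz) fun t ht =>
      ?_).differentiableAt.differentiableWithinAt
    have h1 := hs t ht
    have h2 := norm_sub_le_norm_sub_add_norm_sub z (bpt t) ζ
    rw [norm_sub_rev z (bpt t)] at h2
    linarith

theorem dNormSq_zero_le (μ : Measure ℂ) : dNormSq μ (fun _ => 0) ≤ 0 := by
  have h1 := (hardyNormSq_le (F := fun _ => 0) (S := 0) (by simp)).2
  have h2 : dirichletIntegral μ (fun _ => 0) = 0 := by simp [dirichletIntegral, dirichletDensity]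
  rw [dNormSq, h2]
  linarith

theorem mem_closedSpan_self {μ : Measure ℂ} {f : ℂ → ℂ} (hf : MemD μ f) : f ∈ closedSpan μ f := by
  refine ⟨hf, fun ε hε => ⟨1, ?_⟩⟩
  simpa using (dNormSq_zero_le μ).trans_lt hε

theorem tendsto_integral_norm_sub_max {u : ℝ → ℝ} (hu : Integrable u θm) :
    Tendsto (fun n : ℕ => ∫ t, ‖u t - max (u t) (-(n : ℝ))‖ ∂θm) atTop (𝓝 0) := by
  have h : Tendsto (fun n : ℕ => ∫ t, ‖u t - max (u t) (-(n : ℝ))‖ ∂θm) atTop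
      (𝓝 (∫ _, (0:ℝ) ∂θm)) := by
    refine tendsto_integral_of_dominated_convergence (fun t => ‖u t‖) (fun n => ?_) hu.norm
      (fun n => Eventually.of_forall fun t => ?_) (Eventually.of_forall fun t => ?_)
    · exact (hu.aestronglyMeasurable.sub
        (hu.aestronglyMeasurable.sup aestronglyMeasurable_const)).norm
    · rw [norm_norm, Real.norm_eq_abs, Real.norm_eq_abs]
      have hn : (0:ℝ) ≤ n := n.cast_nonneg
      rcases le_total (u t) (-(n : ℝ)) with h | h
      · rw [max_eq_right h, abs_of_nonpos (by linarith), abs_of_nonpos (by linarith)]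
        linarith
      · simp [max_eq_left h]
    · refine tendsto_const_nhds.congr' ?_
      obtain ⟨m, hm⟩ := exists_nat_ge (-u t)
      filter_upwards [eventually_ge_atTop m] with n hn
      have : (m : ℝ) ≤ n := by exact_mod_cast hn
      simp [max_eq_left (show -(n : ℝ) ≤ u t by linarith)]
  simpa using h

theorem exists_polynomial_smallAt_exp_neg_herg {f : ℂ → ℂ} (hf : DifferentiableOn ℂ f disc)
    {u : ℝ → ℝ} (hu : Integrable u θm) {ζ : ℂ} {δ : ℝ} (hδ : 0 < δ)
    (hs : ∀ t, u t ≠ 0 → ‖bpt t - ζ‖ < δ / 2) {B : ℝ} (hB0 : 0 ≤ B)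
    (hfB : ∀ z ∈ disc, ‖f z‖ ≤ B) (hB : ∀ z ∈ disc, ‖f z * exp (-herg u z)‖ ≤ B) {ε : ℝ}
    (hε : 0 < ε) :
    ∃ q : Polynomial ℂ, SmallAt f ζ δ ε (fun z => exp (-herg u z) - q.eval z) := by
  have hε4 : 0 < ε / 4 := by positivity
  obtain ⟨η, hη, hηs⟩ := exists_smallAt_mul_one_sub_exp hf hu hδ hs hB hε4
  obtain ⟨n, hn⟩ := ((tendsto_integral_norm_sub_max hu).eventually_le_const hη).exists
  set v : ℝ → ℝ := {t | ‖bpt t - ζ‖ < δ / 2}.indicator fun t => max (u t) (-(n : ℝ)) with hv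
  have hJ : MeasurableSet {t | ‖bpt t - ζ‖ < δ / 2} := by
    have := measurable_bpt
    exact measurableSet_lt (by fun_prop) measurable_const
  have hvi : Integrable v θm := (hu.sup (integrable_const _)).indicator hJ
  have hvs : ∀ t, v t ≠ 0 → ‖bpt t - ζ‖ < δ / 2 := fun t ht => by
    by_contra h; simp [hv, h] at ht
  have hw0 : ∀ t, (u - v) t ≤ 0 := fun t => by
    by_cases ht : ‖bpt t - ζ‖ < δ / 2
    · simp [hv, ht]
    · have : u t = 0 := by_contra fun h => ht (hs t h)
      simp [hv, ht, this]
  have hws : ∀ t, (u - v) t ≠ 0 → ‖bpt t - ζ‖ < δ / 2 := fun t ht => by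
    by_contra h
    have h1 : u t = 0 := by_contra fun h' => h (hs t h')
    have h2 : v t = 0 := by_contra fun h' => h (hvs t h')
    simp [h1, h2] at ht
  have hwn : ∫ t, ‖(u - v) t‖ ∂θm ≤ η := by
    refine le_trans (integral_mono (hu.sub hvi).norm
      (hu.sub (hu.sup (integrable_const (-(n : ℝ))))).norm fun t => ?_) hn
    by_cases ht : ‖bpt t - ζ‖ < δ / 2
    · simp [hv, ht]
    · have : u t = 0 := by_contra fun h => ht (hs t h)
      simp [hv, ht, this]
  have s1 := hηs (u - v) (hu.sub hvi) hw0 hws hwn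
  have hvB : ∀ z ∈ disc, ‖exp (-herg v z)‖ ≤ Real.exp n := fun z hz => by
    rw [Complex.norm_exp, ← herg_neg]
    refine Real.exp_le_exp.2 (re_herg_le hvi.neg (Eventually.of_forall fun t => ?_) hz)
    by_cases ht : ‖bpt t - ζ‖ < δ / 2
    · have := le_max_right (u t) (-(n : ℝ))
      simp only [Pi.neg_apply, hv, indicator, mem_ofPred_eq, ht, if_true]
      linarith
    · simp [hv, ht]
  obtain ⟨q, s2⟩ := exists_polynomial_smallAt hf hB0 hfB
    (U := disc ∪ {z | δ / 2 < ‖z - ζ‖}) (ζ := ζ) (δ := δ)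
    (isOpen_ball.union (isOpen_lt continuous_const (by fun_prop))) subset_union_left
    (fun z _ hd => Or.inr (by simp only [mem_ofPred_eq]; linarith))
    (differentiableOn_herg_union hvi hvs).fun_neg.cexp hvB hε4
  refine ⟨q, ?_⟩
  have s3 := s1.add hf s2 hε4.le hε4.le
  rw [show 2 * (ε / 4 + ε / 4) = ε by ring] at s3
  refine s3.congr fun z hz => ?_
  have : exp (-herg u z) * exp (herg (u - v) z) = exp (-herg v z) := by
    rw [← Complex.exp_add, herg_sub hu hvi hz]
    congr 1
    ring
  simp only [mul_sub, mul_one, this]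
  ring

theorem mul_mem_closedSpan {μ : Measure ℂ} [IsFiniteMeasure μ] (hμ : OnCircle μ) {f h : ℂ → ℂ}
    (hfD : MemD μ f) {M : ℝ} (hM : ∀ z ∈ disc, ‖f z‖ ≤ M) {ζ : ℂ} {δ : ℝ} (hδ : 0 < δ)
    (h0 : μ (ball ζ (2 * δ)) = 0) {ε₀ : ℝ} (hh : SmallAt f ζ δ ε₀ h)
    (hq : ∀ ε > 0, ∃ q : Polynomial ℂ, SmallAt f ζ δ ε (fun z => h z - q.eval z)) :
    (fun z => f z * h z) ∈ closedSpan μ f := by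
  obtain ⟨K, hK⟩ := SmallAt.dNormSq_mul_le hμ hfD hM hδ h0
  refine ⟨(hK h ε₀ hh).1, fun ε hε => ?_⟩
  obtain ⟨q, hq⟩ := hq (√(ε / (|K| + 1))) (Real.sqrt_pos.2 (by positivity))
  refine ⟨q, ?_⟩
  have h1 := (hK _ _ hq).2
  rw [Real.sq_sqrt (by positivity)] at h1
  have h2 : (fun z => f z * h z - q.eval z * f z) = fun z => f z * (h z - q.eval z) := by
    funext z; ring
  rw [h2]
  refine h1.trans_lt ?_
  rw [mul_div_assoc', div_lt_iff₀ (by positivity)]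
  nlinarith [le_abs_self K]

theorem notMem_Zlow_of_le {g : ℂ → ℂ} {ζ : ℂ} {C a : ℝ} (ha : 0 < a)
    (hC : ∀ z ∈ disc, ‖g z‖ ≤ C) (hg : ∀ᶠ z in 𝓝[disc] ζ, a ≤ ‖g z‖) : ζ ∉ Zlow g := by
  rintro ⟨hζ, hlim⟩
  have hcl : ζ ∈ closure disc := by rwa [disc, closure_ball _ one_ne_zero]
  have : (𝓝[disc] ζ).NeBot := mem_closure_iff_nhdsWithin_neBot.1 hcl
  have hb : IsBoundedUnder (· ≤ ·) (𝓝[disc] ζ) fun z => ‖g z‖ :=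
    isBoundedUnder_of_eventually_le (eventually_mem_nhdsWithin.mono hC)
  have := le_liminf_of_le hb.isCoboundedUnder_ge hg
  linarith

theorem exists_herg_of_isOuter {f : ℂ → ℂ} (hf : IsOuter f) :
    ∃ u : ℝ → ℝ, Integrable u θm ∧ ∀ z ∈ disc, f z = exp (herg u z) := by
  obtain ⟨φ, -, hi, hφ⟩ := hf
  refine ⟨fun t => Real.log (φ t), hi.1, fun z hz => ?_⟩
  rw [hφ z hz, herg, intervalIntegral.integral_of_le Real.two_pi_pos.le, θm]

/-- Near a point off the support of `μ`, some element of `[f]` is bounded away from zero. -/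
theorem exists_mem_closedSpan_notMem_Zlow {μ : Measure ℂ} [IsFiniteMeasure μ] (hμ : OnCircle μ)
    {f : ℂ → ℂ} (hfD : MemD μ f) (hfH : MemHinf f) (hfO : IsOuter f) {ζ : ℂ}
    (hζ : ζ ∉ msupport μ) : ∃ g ∈ closedSpan μ f, ζ ∉ Zlow g := by
  obtain ⟨u, hu, hfu⟩ := exists_herg_of_isOuter hfO
  obtain ⟨hfd, C, hC⟩ := hfH
  obtain ⟨ρ, hρ, h0⟩ : ∃ ρ > 0, μ (ball ζ ρ) = 0 := by
    simpa [msupport] using hζ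
  set c := |Real.log C|
  have hre : ∀ z ∈ disc, (herg u z).re ≤ c := fun z hz => by
    have h1 := hC z hz
    rw [hfu z hz, Complex.norm_exp] at h1
    exact ((Real.le_log_iff_exp_le ((Real.exp_pos _).trans_le h1)).2 h1).trans (le_abs_self _)
  have hae := ae_le_of_re_herg_le hu hre
  have hfB : ∀ z ∈ disc, ‖f z‖ ≤ Real.exp c := fun z hz => by
    rw [hfu z hz, Complex.norm_exp]
    exact Real.exp_le_exp.2 (hre z hz)
  set δ := ρ / 2 with hδdef
  have hδ : 0 < δ := by positivity
  have hJ : MeasurableSet {t | ‖bpt t - ζ‖ < δ / 2} := by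
    have := measurable_bpt
    exact measurableSet_lt (by fun_prop) measurable_const
  set v : ℝ → ℝ := {t | ‖bpt t - ζ‖ < δ / 2}.indicator u with hv
  have hvi : Integrable v θm := hu.indicator hJ
  have hvs : ∀ t, v t ≠ 0 → ‖bpt t - ζ‖ < δ / 2 := fun t ht => by
    by_contra h; simp [hv, h] at ht
  have hg : ∀ z ∈ disc, f z * exp (-herg v z) = exp (herg (u - v) z) := fun z hz => by
    rw [hfu z hz, ← Complex.exp_add, herg_sub hu hvi hz, sub_eq_add_neg]
  have hgB : ∀ z ∈ disc, ‖f z * exp (-herg v z)‖ ≤ Real.exp c := fun z hz => by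
    rw [hg z hz, Complex.norm_exp]
    refine Real.exp_le_exp.2 (re_herg_le (hu.sub hvi) ?_ hz)
    filter_upwards [hae] with t ht
    by_cases htJ : ‖bpt t - ζ‖ < δ / 2
    · simp [hv, htJ, c]
    · simpa [hv, htJ] using ht
  have hhd : DifferentiableOn ℂ (fun z => exp (-herg v z)) disc :=
    (differentiableOn_herg hvi).fun_neg.cexp
  obtain ⟨H, hH0, hH⟩ := exists_bound_exp_neg_herg hvi hδ hvs
  have hc0 := Real.exp_pos c
  have hsmall : SmallAt f ζ δ (H + 3 * Real.exp c) fun z => exp (-herg v z) :=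
    { diff := hhd
      bound := fun z hz hd => by linarith [(hH z hz hd).1]
      bound_deriv := fun z hz hd => by linarith [(hH z hz hd).2]
      mean := fun r hr hr1 => by
        refine (integral_normSq_le_of_bound (hfd.mul hhd) hgB hr.le hr1).trans ?_
        nlinarith [Real.pi_lt_d2, mul_nonneg hH0 hc0.le, sq_nonneg H, sq_nonneg (Real.exp c)] }
  have hmem := mul_mem_closedSpan hμ hfD hfB hδ
    (by rwa [hδdef, mul_div_cancel₀ ρ two_ne_zero]) hsmall fun ε hε =>
      exists_polynomial_smallAt_exp_neg_herg hfd hvi hδ hvs hc0.le hfB hgB hε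
  refine ⟨_, hmem, notMem_Zlow_of_le
    (Real.exp_pos (-(2 / (δ / 4) * ∫ t, ‖(u - v) t‖ ∂θm))) hgB ?_⟩
  have hδ4 : 0 < δ / 4 := by positivity
  filter_upwards [self_mem_nhdsWithin, mem_nhdsWithin_of_mem_nhds (ball_mem_nhds ζ hδ4)]
    with z hz hzb
  have hz1 : ‖z‖ < 1 := by simpa [disc] using hz
  rw [mem_ball, dist_eq_norm] at hzb
  rw [hg z hz, Complex.norm_exp]
  refine Real.exp_le_exp.2 ((neg_le_neg (norm_herg_le (hu.sub hvi) hδ4 (fun t ht => ?_)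
    hz1.le)).trans (neg_le_of_abs_le (Complex.abs_re_le_norm _)))
  have h1 : δ / 2 ≤ ‖bpt t - ζ‖ := by
    by_contra h
    simp [hv, not_le.1 h] at ht
  have h2 := norm_sub_le_norm_sub_add_norm_sub (bpt t) z ζ
  linarith

/-- For an outer `f ∈ D(μ) ∩ H^∞`, `Z̲([f]_{D(μ)}) ⊆ Z̲(f) ∩ supp μ`. -/
theorem ZlowSet_closedSpan_subset
    (μ : Measure ℂ) [IsFiniteMeasure μ] (hμ : OnCircle μ)
    (f : ℂ → ℂ) (hfD : MemD μ f) (hfH : MemHinf f) (hfO : IsOuter f) :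
    ZlowSet (closedSpan μ f) ⊆ Zlow f ∩ msupport μ := by
  intro ζ hζ
  have hall : ∀ g ∈ closedSpan μ f, ζ ∈ Zlow g := by simpa [ZlowSet] using hζ
  refine ⟨hall f (mem_closedSpan_self hfD), ?_⟩
  by_contra hn
  obtain ⟨g, hg, hgz⟩ := exists_mem_closedSpan_notMem_Zlow hμ hfD hfH hfO hn
  exact hgz (hall g hg)

end DirichletMu
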